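/- Suppose 3 ≤ n ≤ 10 and p > 1, or n ≥ 11 and 1 < p < p_c(n). Assume ψ satisfies (H1)–(H3). For α ≥ 0 let u_α denote the unique radial solution with initial value α. Then there exists α₀ ∈ (0, ∞) such that: (i) u_α is stable for every α ∈ [0, α₀]; (ii) u_α is unstable for every α > α₀. Moreover α₀ ≥ (λ₁/p)^{1/(p−1)}, where λ₁ is the radial Poincaré constant. -/

import Mathlib

open Real MeasureTheory Filter Set Asymptotics

noncomputable section

/-- (H1): ψ is C² on [0,∞), ψ(0) = ψ''(0) = 0, ψ'(0) = 1, ψ > 0 on (0,∞). -/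
def H1 (ψ : ℝ → ℝ) : Prop :=
  ContDiffOn ℝ 2 ψ (Ici 0) ∧ ψ 0 = 0 ∧ deriv ψ 0 = 1 ∧
    deriv (deriv ψ) 0 = 0 ∧ ∀ r > (0 : ℝ), 0 < ψ r

/-- (H2): ψ' ≥ 0 on (0,∞). -/
def H2 (ψ : ℝ → ℝ) : Prop := ∀ r > (0 : ℝ), 0 ≤ deriv ψ r

/-- (H3): liminf_{r→∞} ψ'(r)/ψ(r) > 0, i.e. ψ'/ψ is eventually bounded below
by a positive constant. -/
def H3 (ψ : ℝ → ℝ) : Prop := ∃ c > (0 : ℝ), ∀ᶠ r in atTop, c ≤ deriv ψ r / ψ r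

/-- A radial solution of the Lane–Emden–Fowler equation with initial value α. -/
def IsRadialSolution (n : ℕ) (p : ℝ) (ψ u : ℝ → ℝ) (α : ℝ) : Prop :=
  ContDiffOn ℝ 2 u (Ici 0) ∧ u 0 = α ∧ deriv u 0 = 0 ∧
    ∀ r > (0 : ℝ), deriv (deriv u) r + ((n : ℝ) - 1) * (deriv ψ r / ψ r) * deriv u r
      + |u r| ^ (p - 1) * u r = 0

/-- Linearized stability of a radial solution. -/
def Stable (n : ℕ) (p : ℝ) (ψ u : ℝ → ℝ) : Prop :=
  ∀ χ : ℝ → ℝ, ContDiff ℝ 1 χ → HasCompactSupport χ →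
    p * ∫ r in Ioi (0:ℝ), |u r| ^ (p - 1) * (χ r) ^ 2 * ψ r ^ (n - 1) ≤
      ∫ r in Ioi (0:ℝ), (deriv χ r) ^ 2 * ψ r ^ (n - 1)

/-- The Joseph–Lundgren exponent. -/
def pJL (n : ℕ) : ℝ :=
  (((n : ℝ) - 2) ^ 2 - 4 * (n : ℝ) + 8 * Real.sqrt ((n : ℝ) - 1)) /
    (((n : ℝ) - 2) * ((n : ℝ) - 10))

/-- The radial Poincaré constant λ₁: the infimum of the Rayleigh quotients of
nonzero compactly supported C¹ functions. -/
def lam1 (n : ℕ) (ψ : ℝ → ℝ) : ℝ :=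
  sInf { q : ℝ | ∃ φ : ℝ → ℝ, ContDiff ℝ 1 φ ∧ HasCompactSupport φ ∧
    (∫ r in Ioi (0:ℝ), (φ r) ^ 2 * ψ r ^ (n - 1)) ≠ 0 ∧
    q = (∫ r in Ioi (0:ℝ), (deriv φ r) ^ 2 * ψ r ^ (n - 1)) /
        (∫ r in Ioi (0:ℝ), (φ r) ^ 2 * ψ r ^ (n - 1)) }

/-- A radial volume density `m` with logarithmic derivative `k`. -/
structure RadialWeight (m k : ℝ → ℝ) : Prop where
  cont : ContinuousOn m (Ici 0)
  zero : m 0 = 0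
  pos : ∀ r > 0, 0 < m r
  hasDeriv : ∀ r > 0, HasDerivAt m (k r * m r) r
  coeff_nonneg : ∀ r > 0, 0 ≤ k r

/-- A solution `u` of the Lane–Emden–Fowler equation with drift `k` and derivative `d`. -/
structure RadialProfile (p : ℝ) (k u d : ℝ → ℝ) : Prop where
  cont : ContinuousOn u (Ici 0)
  cont_deriv : ContinuousOn d (Ici 0)
  deriv_zero : d 0 = 0
  hasDeriv : ∀ r > 0, HasDerivAt u (d r) r
  hasDeriv_deriv : ∀ r > 0, HasDerivAt d (-(k r * d r) - |u r| ^ (p - 1) * u r) r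

/-- Linearized stability with respect to the density `m`. -/
def WeightedStable (p : ℝ) (m u : ℝ → ℝ) : Prop :=
  ∀ χ : ℝ → ℝ, ContDiff ℝ 1 χ → HasCompactSupport χ →
    p * ∫ r in Ioi (0:ℝ), |u r| ^ (p - 1) * (χ r) ^ 2 * m r ≤
      ∫ r in Ioi (0:ℝ), (deriv χ r) ^ 2 * m r

/-! ### Calculus on an interval -/

theorem le_of_hasDerivAt_nonneg {f f' : ℝ → ℝ} {a b : ℝ} (hab : a ≤ b)
    (hf : ContinuousOn f (Icc a b)) (hd : ∀ x ∈ Ioo a b, HasDerivAt f (f' x) x)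
    (h0 : ∀ x ∈ Ioo a b, 0 ≤ f' x) : f a ≤ f b := by
  refine monotoneOn_of_deriv_nonneg (convex_Icc a b) hf ?_ ?_ (left_mem_Icc.2 hab)
    (right_mem_Icc.2 hab) hab
  · rw [interior_Icc]
    exact fun x hx => (hd x hx).differentiableAt.differentiableWithinAt
  · rw [interior_Icc]
    intro x hx
    rw [(hd x hx).deriv]
    exact h0 x hx

theorem lt_of_hasDerivAt_pos {f f' : ℝ → ℝ} {a b : ℝ} (hab : a < b)
    (hf : ContinuousOn f (Icc a b)) (hd : ∀ x ∈ Ioo a b, HasDerivAt f (f' x) x)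
    (h0 : ∀ x ∈ Ioo a b, 0 < f' x) : f a < f b := by
  refine strictMonoOn_of_deriv_pos (convex_Icc a b) hf ?_ (left_mem_Icc.2 hab.le)
    (right_mem_Icc.2 hab.le) hab
  rw [interior_Icc]
  intro x hx
  rw [(hd x hx).deriv]
  exact h0 x hx

theorem le_of_hasDerivAt_nonpos {f f' : ℝ → ℝ} {a b : ℝ} (hab : a ≤ b)
    (hf : ContinuousOn f (Icc a b)) (hd : ∀ x ∈ Ioo a b, HasDerivAt f (f' x) x)
    (h0 : ∀ x ∈ Ioo a b, f' x ≤ 0) : f b ≤ f a := by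
  have := le_of_hasDerivAt_nonneg (f := fun x => -f x) (f' := fun x => -f' x) hab hf.neg
    (fun x hx => (hd x hx).neg) (fun x hx => neg_nonneg.2 (h0 x hx))
  exact neg_le_neg_iff.1 this

theorem exists_first_zero {w : ℝ → ℝ} (hw : ContinuousOn w (Ici 0)) (h0 : 0 < w 0) {r : ℝ}
    (hr : 0 ≤ r) (hwr : w r ≤ 0) :
    ∃ R, 0 < R ∧ R ≤ r ∧ w R = 0 ∧ ∀ s, 0 ≤ s → s < R → 0 < w s := by
  have hc : ContinuousOn w (Icc 0 r) := hw.mono Icc_subset_Ici_self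
  have hcl : IsClosed (Icc 0 r ∩ w ⁻¹' Iic 0) := hc.preimage_isClosed_of_isClosed isClosed_Icc
    isClosed_Iic
  have hcomp : IsCompact (Icc 0 r ∩ w ⁻¹' Iic 0) :=
    isCompact_Icc.of_isClosed_subset hcl inter_subset_left
  obtain ⟨R, ⟨⟨hR0, hRr⟩, hwR⟩, hleast⟩ := hcomp.exists_isLeast ⟨r, ⟨hr, le_rfl⟩, hwr⟩
  have hwR' : w R ≤ 0 := hwR
  have hz : w R = 0 := by
    obtain ⟨s, ⟨hs0, hsR⟩, hs⟩ := intermediate_value_Icc' hR0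
      (hw.mono Icc_subset_Ici_self : ContinuousOn w (Icc 0 R)) ⟨hwR', h0.le⟩
    have : R ≤ s := hleast ⟨⟨hs0, hsR.trans hRr⟩, hs.le⟩
    rw [← hs, le_antisymm hsR this]
  refine ⟨R, ?_, hRr, hz, ?_⟩
  · rcases hR0.lt_or_eq with h | h
    · exact h
    · rw [← h] at hz
      exact absurd hz h0.ne'
  · intro s hs hsR
    by_contra hcon
    exact absurd (hleast ⟨⟨hs, hsR.le.trans hRr⟩, not_lt.1 hcon⟩) (not_le.2 hsR)

theorem integrableOn_Ioi_of_eq_zero {F : ℝ → ℝ} {R : ℝ} (hF : ContinuousOn F (Ici 0))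
    (hR : 0 ≤ R) (hz : ∀ r > R, F r = 0) : IntegrableOn F (Ioi 0) := by
  rw [← Ioc_union_Ioi_eq_Ioi hR]
  refine IntegrableOn.union ?_ ?_
  · exact ((hF.mono Icc_subset_Ici_self).integrableOn_Icc).mono_set Ioc_subset_Icc_self
  · exact integrableOn_zero.congr_fun (fun r hr => (hz r hr).symm) measurableSet_Ioi

theorem setIntegral_Ioi_of_eq_zero {F : ℝ → ℝ} {R : ℝ} (hR : 0 ≤ R)
    (hz : ∀ r > R, F r = 0) : ∫ r in Ioi (0:ℝ), F r = ∫ r in (0:ℝ)..R, F r := by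
  rw [intervalIntegral.integral_of_le hR]
  refine setIntegral_eq_of_subset_of_forall_sdiff_eq_zero measurableSet_Ioi
    Ioc_subset_Ioi_self ?_
  rintro x ⟨hx, hx'⟩
  exact hz x (not_le.1 fun h => hx' ⟨hx, h⟩)

theorem exists_bound_of_hasCompactSupport {χ : ℝ → ℝ} (hχ : HasCompactSupport χ) :
    ∃ R > 0, ∀ r, R ≤ r → χ r = 0 ∧ deriv χ r = 0 := by
  obtain ⟨A, hA⟩ := hχ.isCompact.bddAbove
  refine ⟨max A 0 + 1, by positivity, fun r hr => ?_⟩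
  have hr' : r ∉ tsupport χ := fun h => by
    have := hA h
    have := le_max_left A 0
    linarith
  refine ⟨image_eq_zero_of_notMem_tsupport hr', ?_⟩
  exact image_eq_zero_of_notMem_tsupport fun h => hr' (tsupport_deriv_subset h)

theorem contDiff_one_continuous_deriv {χ : ℝ → ℝ} (hχ : ContDiff ℝ 1 χ) :
    Continuous (deriv χ) :=
  hχ.continuous_deriv le_rfl

/-- A `C¹` function on `[0, R]` with vanishing value and slope at `R` and vanishing slope at `0`
is an admissible test function. -/
theorem WeightedStable.intervalIntegral_le {p : ℝ} {m u g g' : ℝ → ℝ} {R : ℝ}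
    (hs : WeightedStable p m u) (hR : 0 < R) (hg : ContinuousOn g (Icc 0 R))
    (hg' : ContinuousOn g' (Icc 0 R)) (hd : ∀ r ∈ Ioo 0 R, HasDerivAt g (g' r) r)
    (h0 : g' 0 = 0) (hR1 : g' R = 0) (hR0 : g R = 0) :
    p * ∫ r in (0:ℝ)..R, |u r| ^ (p - 1) * g r ^ 2 * m r ≤
      ∫ r in (0:ℝ)..R, g' r ^ 2 * m r := by
  set K : ℝ → ℝ := IccExtend hR.le ((Icc 0 R).domRestrict g') with hK
  have Kc : Continuous K := (continuousOn_iff_continuous_domRestrict.1 hg').Icc_extend'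
  have Kle : ∀ r ≤ 0, K r = 0 := fun r hr => by
    rw [hK, IccExtend_of_le_left _ _ hr]; exact h0
  have Kge : ∀ r, R ≤ r → K r = 0 := fun r hr => by
    rw [hK, IccExtend_of_right_le _ _ hr]; exact hR1
  have Kmem : ∀ r ∈ Icc 0 R, K r = g' r := fun r hr => by
    rw [hK, IccExtend_of_mem _ _ hr]; rfl
  set X : ℝ → ℝ := fun r => g 0 + ∫ t in (0:ℝ)..r, K t with hX
  have Xd : ∀ r, HasDerivAt X (K r) r := fun r =>
    (intervalIntegral.integral_hasDerivAt_right (Kc.intervalIntegrable _ _)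
      (Kc.stronglyMeasurableAtFilter _ _) Kc.continuousAt).const_add _
  have Xle : ∀ r ≤ 0, X r = g 0 := fun r hr => by
    have : ∫ t in (0:ℝ)..r, K t = ∫ t in (0:ℝ)..r, (0:ℝ) := by
      refine intervalIntegral.integral_congr fun t ht => ?_
      rw [uIcc_of_ge hr] at ht
      exact Kle t ht.2
    simp [hX, this]
  have Xmem : ∀ r ∈ Icc 0 R, X r = g r := fun r hr => by
    have h1 : ∫ t in (0:ℝ)..r, K t = g r - g 0 := by
      refine intervalIntegral.integral_eq_sub_of_hasDerivAt_of_le hr.1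
        (hg.mono (Icc_subset_Icc_right hr.2)) (fun t ht => ?_) (Kc.intervalIntegrable _ _)
      have ht' : t ∈ Ioo 0 R := ⟨ht.1, ht.2.trans_le hr.2⟩
      rw [Kmem t (Ioo_subset_Icc_self ht')]
      exact hd t ht'
    simp [hX, h1]
  have Xge : ∀ r, R ≤ r → X r = 0 := fun r hr => by
    have h1 : X R = 0 := by rw [Xmem R ⟨hR.le, le_rfl⟩, hR0]
    have h2 : ∫ t in R..r, K t = ∫ t in R..r, (0:ℝ) := by
      refine intervalIntegral.integral_congr fun t ht => ?_
      rw [uIcc_of_le hr] at ht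
      exact Kge t ht.1
    have h3 : X r = X R + ∫ t in R..r, K t := by
      simp only [hX]
      rw [add_assoc, intervalIntegral.integral_add_adjacent_intervals
        (Kc.intervalIntegrable _ _) (Kc.intervalIntegrable _ _)]
    rw [h3, h1, h2]
    simp
  set χ : ℝ → ℝ := fun r => X r + X (-r) - g 0 with hχ
  have χd : ∀ r, HasDerivAt χ (K r - K (-r)) r := fun r => by
    have h1 : HasDerivAt (fun r => X (-r)) (K (-r) * -1) r :=
      (Xd (-r)).comp r (hasDerivAt_neg r)
    exact (((Xd r).add h1).sub_const (g 0)).congr_deriv (by ring)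
  have χderiv : deriv χ = fun r => K r - K (-r) := funext fun r => (χd r).deriv
  have χC : ContDiff ℝ 1 χ := by
    rw [contDiff_one_iff_deriv]
    refine ⟨fun r => (χd r).differentiableAt, ?_⟩
    rw [χderiv]
    exact Kc.sub (Kc.comp continuous_neg)
  have χpos : ∀ r, 0 ≤ r → χ r = X r := fun r hr => by
    simp only [hχ]
    rw [Xle (-r) (by linarith)]; ring
  have χ'pos : ∀ r, 0 ≤ r → deriv χ r = K r := fun r hr => by
    rw [χderiv]
    simp only
    rw [Kle (-r) (by linarith)]; ring
  have χs : HasCompactSupport χ := by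
    refine HasCompactSupport.of_support_subset_isCompact (isCompact_Icc (a := -R) (b := R)) ?_
    intro r hr
    by_contra hcon
    apply hr
    rw [mem_Icc, not_and_or, not_le, not_le] at hcon
    simp only [hχ]
    rcases hcon with h | h
    · rw [Xle r (by linarith), Xge (-r) (by linarith)]; ring
    · rw [Xle (-r) (by linarith), Xge r h.le]; ring
  have key := hs χ χC χs
  rw [setIntegral_Ioi_of_eq_zero (R := R) hR.le, setIntegral_Ioi_of_eq_zero (R := R) hR.le] at key
  · have e1 : ∫ r in (0:ℝ)..R, |u r| ^ (p - 1) * χ r ^ 2 * m r =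
        ∫ r in (0:ℝ)..R, |u r| ^ (p - 1) * g r ^ 2 * m r := by
      refine intervalIntegral.integral_congr fun t ht => ?_
      rw [uIcc_of_le hR.le] at ht
      rw [χpos t ht.1, Xmem t ht]
    have e2 : ∫ r in (0:ℝ)..R, deriv χ r ^ 2 * m r = ∫ r in (0:ℝ)..R, g' r ^ 2 * m r := by
      refine intervalIntegral.integral_congr fun t ht => ?_
      rw [uIcc_of_le hR.le] at ht
      rw [χ'pos t ht.1, Kmem t ht]
    rwa [e1, e2] at key
  · intro r hr
    rw [χ'pos r (hR.le.trans hr.le), Kge r hr.le]; ring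
  · intro r hr
    rw [χpos r (hR.le.trans hr.le), Xge r hr.le]; ring

/-! ### The nonlinearity -/

theorem bernoulli_gap {p a b : ℝ} (hp : 1 < p) (ha : 0 ≤ a) (hab : a < b) :
    |b| ^ (p - 1) * b - |a| ^ (p - 1) * a < p * |b| ^ (p - 1) * (b - a) := by
  have hb : 0 < b := ha.trans_lt hab
  rw [abs_of_pos hb, abs_of_nonneg ha]
  have e1 : ∀ x : ℝ, 0 ≤ x → x ^ (p - 1) * x = x ^ p := fun x hx => by
    rcases hx.eq_or_lt with h | h
    · rw [← h, Real.zero_rpow (by linarith), Real.zero_rpow (by linarith), zero_mul]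
    · rw [Real.rpow_sub_one h.ne', div_mul_cancel₀ _ h.ne']
  have hB := one_add_mul_self_lt_rpow_one_add (s := a / b - 1) (p := p)
    (by have := div_nonneg ha hb.le; linarith)
    (by have := (div_lt_one hb).2 hab; linarith) hp
  have h2 : (1 + (a / b - 1)) = a / b := by ring
  rw [h2, Real.div_rpow ha hb.le, lt_div_iff₀ (Real.rpow_pos_of_pos hb p), ← e1 b hb.le,
    ← e1 a ha] at hB
  have h3 : (1 + p * (a / b - 1)) * (b ^ (p - 1) * b)
      = b ^ (p - 1) * b + p * b ^ (p - 1) * (a - b) := by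
    field_simp
  rw [h3] at hB
  linarith

theorem abs_rpow_mul_self_sub_le {p M x y : ℝ} (hp : 1 < p) (hx : |x| ≤ M) (hy : |y| ≤ M) :
    abs (|x| ^ (p - 1) * x - |y| ^ (p - 1) * y) ≤ p * M ^ (p - 1) * |x - y| := by
  have aux : ∀ x y : ℝ, 0 ≤ x → |y| ≤ x →
      abs (|x| ^ (p - 1) * x - |y| ^ (p - 1) * y) ≤ p * |x| ^ (p - 1) * |x - y| := by
    intro x y hx hyx
    have hmon : |y| ^ (p - 1) ≤ |x| ^ (p - 1) :=
      Real.rpow_le_rpow (abs_nonneg _) (by rwa [abs_of_nonneg hx]) (by linarith)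
    have hx0 : 0 ≤ |x| ^ (p - 1) := by positivity
    have hy0 : 0 ≤ |y| ^ (p - 1) := by positivity
    have hle : y ≤ x := (le_abs_self y).trans hyx
    rw [abs_of_nonneg (sub_nonneg.2 hle)]
    rcases le_total 0 y with h | h
    · have h1 : |y| ^ (p - 1) * y ≤ |x| ^ (p - 1) * x := mul_le_mul hmon hle h hx0
      rw [abs_of_nonneg (sub_nonneg.2 h1)]
      rcases hle.lt_or_eq with h2 | h2
      · exact (bernoulli_gap hp h h2).le
      · rw [h2]; simp
    · have h1 : |y| ^ (p - 1) * y ≤ 0 := mul_nonpos_of_nonneg_of_nonpos hy0 h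
      have h2 : 0 ≤ |x| ^ (p - 1) * x := mul_nonneg hx0 hx
      rw [abs_of_nonneg (by linarith)]
      have h3 : |x| ^ (p - 1) * y ≤ |y| ^ (p - 1) * y := mul_le_mul_of_nonpos_right hmon h
      have h4 : 0 ≤ |x| ^ (p - 1) * (x - y) := mul_nonneg hx0 (by linarith)
      nlinarith
  have aux2 : ∀ x y : ℝ, |y| ≤ |x| →
      abs (|x| ^ (p - 1) * x - |y| ^ (p - 1) * y) ≤ p * |x| ^ (p - 1) * |x - y| := by
    intro x y hxy
    rcases le_total 0 x with h | h
    · exact aux x y h (by rwa [abs_of_nonneg h] at hxy)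
    · have := aux (-x) (-y) (by linarith) (by rwa [abs_neg, ← abs_of_nonpos h])
      rw [abs_neg, abs_neg] at this
      calc abs (|x| ^ (p - 1) * x - |y| ^ (p - 1) * y)
          = abs (|x| ^ (p - 1) * -x - |y| ^ (p - 1) * -y) := by rw [← abs_neg]; congr 1; ring
        _ ≤ p * |x| ^ (p - 1) * |-x - -y| := this
        _ = p * |x| ^ (p - 1) * |x - y| := by rw [← abs_neg (x - y)]; congr 2; ring
  have mono : ∀ z : ℝ, |z| ≤ M →
      p * |z| ^ (p - 1) * |x - y| ≤ p * M ^ (p - 1) * |x - y| := fun z hz => by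
    have : |z| ^ (p - 1) ≤ M ^ (p - 1) := Real.rpow_le_rpow (abs_nonneg _) hz (by linarith)
    have hp0 : 0 < p := by linarith
    gcongr
  rcases le_total |y| |x| with h | h
  · exact (aux2 x y h).trans (mono x hx)
  · rw [abs_sub_comm]
    refine (aux2 y x h).trans ?_
    rw [abs_sub_comm y x]
    exact mono y hy

theorem continuousOn_abs_rpow {p : ℝ} (hp : 1 < p) {u : ℝ → ℝ} {s : Set ℝ}
    (hu : ContinuousOn u s) : ContinuousOn (fun r => |u r| ^ (p - 1)) s :=
  hu.abs.rpow_const fun _ _ => Or.inr (by linarith)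

/-! ### A priori bounds -/

theorem RadialProfile.abs_le {p α : ℝ} {k u d : ℝ → ℝ} (h : RadialProfile p k u d)
    (hk : ∀ r > 0, 0 ≤ k r) (hp : 1 < p) (hα : u 0 = α) (hα0 : 0 ≤ α) {r : ℝ} (hr : 0 ≤ r) :
    |u r| ≤ α := by
  have key : d r ^ 2 / 2 + |u r| ^ (p + 1) / (p + 1)
      ≤ d 0 ^ 2 / 2 + |u 0| ^ (p + 1) / (p + 1) := by
    refine le_of_hasDerivAt_nonpos (f := fun r => d r ^ 2 / 2 + |u r| ^ (p + 1) / (p + 1))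
      (f' := fun r => -(k r * d r ^ 2)) hr ?_ ?_ ?_
    · have hd := h.cont_deriv.mono (Icc_subset_Ici_self : Icc 0 r ⊆ Ici 0)
      have hu := h.cont.mono (Icc_subset_Ici_self : Icc 0 r ⊆ Ici 0)
      exact ((hd.pow 2).div_const 2).add
        ((hu.abs.rpow_const fun _ _ => Or.inr (by linarith)).div_const _)
    · intro x hx
      have h1 := ((h.hasDeriv_deriv x hx.1).pow 2).div_const 2
      have h2 := ((hasDerivAt_abs_rpow (u x) (show 1 < p + 1 by linarith)).comp x
        (h.hasDeriv x hx.1)).div_const (p + 1)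
      refine (h1.add h2).congr_deriv ?_
      have hp1 : p + 1 ≠ 0 := by linarith
      have : p + 1 - 2 = p - 1 := by ring
      rw [this]
      field_simp
      push_cast
      ring
    · intro x hx
      have := mul_nonneg (hk x hx.1) (sq_nonneg (d x))
      linarith
  have hp1 : 0 < p + 1 := by linarith
  rw [h.deriv_zero, hα, abs_of_nonneg hα0] at key
  have h3 : |u r| ^ (p + 1) / (p + 1) ≤ α ^ (p + 1) / (p + 1) := by nlinarith [sq_nonneg (d r)]
  have h4 : |u r| ^ (p + 1) ≤ α ^ (p + 1) := by rwa [div_le_div_iff_of_pos_right hp1] at h3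
  exact (Real.rpow_le_rpow_iff (abs_nonneg _) hα0 hp1).1 h4

/-- Lipschitz dependence on the initial value. -/
theorem RadialProfile.sq_sub_le {p α β M : ℝ} {k u d v e : ℝ → ℝ} (hu : RadialProfile p k u d)
    (hv : RadialProfile p k v e) (hk : ∀ r > 0, 0 ≤ k r) (hp : 1 < p) (hα : u 0 = α)
    (hβ : v 0 = β) (hα0 : 0 ≤ α) (hβ0 : 0 ≤ β) (hαM : α ≤ M) (hβM : β ≤ M) {r : ℝ} (hr : 0 ≤ r) :
    (u r - v r) ^ 2 ≤ exp ((p * M ^ (p - 1) + 1) * r) * (α - β) ^ 2 := by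
  set L := p * M ^ (p - 1) with hL
  have key : exp (-((L + 1) * r)) * ((d r - e r) ^ 2 + (u r - v r) ^ 2)
      ≤ exp (-((L + 1) * 0)) * ((d 0 - e 0) ^ 2 + (u 0 - v 0) ^ 2) := by
    refine le_of_hasDerivAt_nonpos
      (f := fun r => exp (-((L + 1) * r)) * ((d r - e r) ^ 2 + (u r - v r) ^ 2))
      (f' := fun r => exp (-((L + 1) * r)) *
        (-(L + 1) * ((d r - e r) ^ 2 + (u r - v r) ^ 2) +
          (2 * (d r - e r) * (-(k r * (d r - e r))
            - (|u r| ^ (p - 1) * u r - |v r| ^ (p - 1) * v r))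
            + 2 * (u r - v r) * (d r - e r)))) hr ?_ ?_ ?_
    · have h1 := hu.cont_deriv.mono (Icc_subset_Ici_self : Icc 0 r ⊆ Ici 0)
      have h2 := hu.cont.mono (Icc_subset_Ici_self : Icc 0 r ⊆ Ici 0)
      have h3 := hv.cont_deriv.mono (Icc_subset_Ici_self : Icc 0 r ⊆ Ici 0)
      have h4 := hv.cont.mono (Icc_subset_Ici_self : Icc 0 r ⊆ Ici 0)
      fun_prop
    · intro x hx
      have h1 : HasDerivAt (fun r => exp (-((L + 1) * r)))
          (exp (-((L + 1) * x)) * -((L + 1) * 1)) x :=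
        (((hasDerivAt_id x).const_mul (L + 1)).neg).exp
      have h2 := ((hu.hasDeriv_deriv x hx.1).sub (hv.hasDeriv_deriv x hx.1)).pow 2
      have h3 := ((hu.hasDeriv x hx.1).sub (hv.hasDeriv x hx.1)).pow 2
      refine (h1.mul (h2.add h3)).congr_deriv ?_
      simp only [Pi.sub_apply, Pi.add_apply, Pi.pow_apply]
      push_cast
      ring
    · intro x hx
      refine mul_nonpos_of_nonneg_of_nonpos (exp_pos _).le ?_
      have hf := abs_rpow_mul_self_sub_le hp
        ((hu.abs_le hk hp hα hα0 hx.1.le).trans hαM) ((hv.abs_le hk hp hβ hβ0 hx.1.le).trans hβM)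
      rw [← hL] at hf
      set a := d x - e x
      set w := u x - v x
      set φ := |u x| ^ (p - 1) * u x - |v x| ^ (p - 1) * v x
      have hk2 := mul_nonneg (hk x hx.1) (sq_nonneg a)
      have hL0 : 0 ≤ L := by
        have : 0 ≤ M := hα0.trans hαM
        positivity
      have h5 : -(a * φ) ≤ |a| * (L * |w|) := by
        calc -(a * φ) ≤ |a * φ| := neg_le_abs _
          _ = |a| * |φ| := abs_mul _ _
          _ ≤ _ := by gcongr
      have h6 : 2 * (|a| * |w|) ≤ a ^ 2 + w ^ 2 := by
        nlinarith [sq_nonneg (|a| - |w|), sq_abs a, sq_abs w]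
      have h7 : w * a ≤ |a| * |w| := by rw [mul_comm, ← abs_mul]; exact le_abs_self _
      nlinarith [mul_le_mul_of_nonneg_left h6 hL0]
  rw [hu.deriv_zero, hv.deriv_zero, hα, hβ] at key
  simp only [mul_zero, neg_zero, exp_zero, sub_self, one_mul, ne_eq, OfNat.ofNat_ne_zero,
    not_false_eq_true, zero_pow, zero_add] at key
  rw [exp_neg, inv_mul_le_iff₀ (exp_pos _)] at key
  nlinarith [sq_nonneg (d r - e r)]

/-! ### Comparison of profiles -/

theorem RadialWeight.hasDerivAt_flux {p : ℝ} {m k u d : ℝ → ℝ} (hw : RadialWeight m k)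
    (hu : RadialProfile p k u d) {r : ℝ} (hr : 0 < r) :
    HasDerivAt (fun r => m r * d r) (-(m r * (|u r| ^ (p - 1) * u r))) r :=
  ((hw.hasDeriv r hr).mul (hu.hasDeriv_deriv r hr)).congr_deriv (by ring)

theorem RadialWeight.nonneg {m k : ℝ → ℝ} (hw : RadialWeight m k) {r : ℝ} (hr : 0 ≤ r) :
    0 ≤ m r := by
  rcases hr.eq_or_lt with h | h
  · rw [← h, hw.zero]
  · exact (hw.pos r h).le

theorem RadialWeight.mono {m k : ℝ → ℝ} (hw : RadialWeight m k) {r s : ℝ} (hr : 0 ≤ r)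
    (hrs : r ≤ s) : m r ≤ m s :=
  le_of_hasDerivAt_nonneg hrs (hw.cont.mono fun _ hx => hr.trans hx.1)
    (fun x hx => hw.hasDeriv x (hr.trans_lt hx.1))
    fun x hx => mul_nonneg (hw.coeff_nonneg x (hr.trans_lt hx.1))
      (hw.pos x (hr.trans_lt hx.1)).le

theorem RadialProfile.deriv_nonpos {p R : ℝ} {m k u d : ℝ → ℝ} (hw : RadialWeight m k)
    (hu : RadialProfile p k u d) (hpos : ∀ r, 0 ≤ r → r < R → 0 < u r) {r : ℝ} (hr : 0 ≤ r)
    (hrR : r ≤ R) : d r ≤ 0 := by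
  rcases hr.eq_or_lt with h | h
  · rw [← h, hu.deriv_zero]
  have key := le_of_hasDerivAt_nonpos (f := fun r => m r * d r) hr
    ((hw.cont.mono Icc_subset_Ici_self).mul (hu.cont_deriv.mono Icc_subset_Ici_self))
    (fun x hx => hw.hasDerivAt_flux hu hx.1) (fun x hx => by
      have h1 := hpos x hx.1.le (hx.2.trans_le hrR)
      have h2 := hw.pos x hx.1
      have : 0 ≤ |u x| ^ (p - 1) := by positivity
      have : 0 ≤ m x * (|u x| ^ (p - 1) * u x) := by positivity
      linarith)
  simp only [hw.zero, zero_mul] at key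
  exact nonpos_of_mul_nonpos_right key (hw.pos r h)

/-- A stable profile cannot be touched from below by a smaller nonnegative profile. -/
theorem WeightedStable.not_touch {p R : ℝ} {m k u d v e : ℝ → ℝ} (hw : RadialWeight m k)
    (hp : 1 < p) (hu : RadialProfile p k u d) (hv : RadialProfile p k v e)
    (hs : WeightedStable p m u) (hR : 0 < R) (hv0 : ∀ r, 0 ≤ r → r ≤ R → 0 ≤ v r)
    (hlt : ∀ r, 0 ≤ r → r < R → v r < u r) (heq : u R = v R) : False := by
  have cm : ContinuousOn m (Icc 0 R) := hw.cont.mono Icc_subset_Ici_self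
  have cu : ContinuousOn u (Icc 0 R) := hu.cont.mono Icc_subset_Ici_self
  have cd : ContinuousOn d (Icc 0 R) := hu.cont_deriv.mono Icc_subset_Ici_self
  have cv : ContinuousOn v (Icc 0 R) := hv.cont.mono Icc_subset_Ici_self
  have ce : ContinuousOn e (Icc 0 R) := hv.cont_deriv.mono Icc_subset_Ici_self
  set U : ℝ → ℝ := fun r => |u r| ^ (p - 1) with hU
  set φ : ℝ → ℝ := fun r => |u r| ^ (p - 1) * u r - |v r| ^ (p - 1) * v r with hφ
  have cU : ContinuousOn U (Icc 0 R) := continuousOn_abs_rpow hp cu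
  have cφ : ContinuousOn φ (Icc 0 R) := (cU.mul cu).sub ((continuousOn_abs_rpow hp cv).mul cv)
  set w : ℝ → ℝ := fun r => u r - v r with hwd
  set w' : ℝ → ℝ := fun r => d r - e r with hwd'
  have cw : ContinuousOn w (Icc 0 R) := cu.sub cv
  have cw' : ContinuousOn w' (Icc 0 R) := cd.sub ce
  have w0 : ∀ r ∈ Icc 0 R, 0 ≤ w r := fun r hr => by
    rcases hr.2.lt_or_eq with h | h
    · exact sub_nonneg.2 (hlt r hr.1 h).le
    · simp [hwd, h, heq]
  have wR : w R = 0 := by simp [hwd, heq]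
  have hwder : ∀ r ∈ Ioo 0 R, HasDerivAt w (w' r) r := fun r hr =>
    (hu.hasDeriv r hr.1).sub (hv.hasDeriv r hr.1)
  have int : ∀ {F : ℝ → ℝ}, ContinuousOn F (Icc 0 R) → IntervalIntegrable F volume 0 R :=
    fun hF => hF.intervalIntegrable_of_Icc hR.le
  have hJ : 0 < ∫ r in (0:ℝ)..R, (p * U r * w r - φ r) * w r * m r := by
    refine intervalIntegral.intervalIntegral_pos_of_pos_on (int (by fun_prop)) ?_ hR
    intro r hr
    have h1 := bernoulli_gap hp (hv0 r hr.1.le hr.2.le) (hlt r hr.1.le hr.2)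
    have h2 : 0 < w r := sub_pos.2 (hlt r hr.1.le hr.2)
    exact mul_pos (mul_pos (sub_pos.2 h1) h2) (hw.pos r hr.1)
  have hT : ∫ r in (0:ℝ)..R, (w' r ^ 2 * m r - φ r * w r * m r) = 0 := by
    have := intervalIntegral.integral_eq_sub_of_hasDerivAt_of_le
      (f := fun r => (m r * d r - m r * e r) * w r)
      (f' := fun r => w' r ^ 2 * m r - φ r * w r * m r) hR.le (by fun_prop)
      (fun r hr => by
        refine (((hw.hasDerivAt_flux hu hr.1).sub (hw.hasDerivAt_flux hv hr.1)).mul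
          (hwder r hr)).congr_deriv ?_
        simp only [Pi.sub_apply, hφ, hwd, hwd']
        ring) (int (by fun_prop))
    rw [this, wR, hw.zero]
    ring
  have main : ∀ ε > 0, ∫ r in (0:ℝ)..R, (p * U r * w r - φ r) * w r * m r
      ≤ ε * ∫ r in (0:ℝ)..R, 2 * p * U r * w r * m r := by
    intro ε hε
    have den : ∀ r ∈ Icc 0 R, w r + ε ≠ 0 := fun r hr => by
      have := w0 r hr
      linarith
    have den2 : ∀ r ∈ Icc 0 R, (w r + ε) ^ 2 ≠ 0 := fun r hr => pow_ne_zero _ (den r hr)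
    have cg : ContinuousOn (fun r => w r ^ 2 / (w r + ε)) (Icc 0 R) :=
      (cw.pow 2).div (cw.add continuousOn_const) den
    have cg' : ContinuousOn (fun r => w' r * (1 - ε ^ 2 / (w r + ε) ^ 2)) (Icc 0 R) :=
      cw'.mul (continuousOn_const.sub
        (continuousOn_const.div ((cw.add continuousOn_const).pow 2) den2))
    have key := hs.intervalIntegral_le hR cg cg'
      (fun r hr => by
        have hd := den r (Ioo_subset_Icc_self hr)
        refine (((hwder r hr).pow 2).div ((hwder r hr).add_const ε) hd).congr_deriv ?_
        simp only [Pi.pow_apply]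
        field_simp
        push_cast
        ring)
      (by simp [hwd', hu.deriv_zero, hv.deriv_zero])
      (by rw [wR]; field_simp; simp) (by rw [wR]; simp)
    have integ1 : IntervalIntegrable (fun r => U r * (w r ^ 2 / (w r + ε)) ^ 2 * m r) volume 0 R :=
      int ((cU.mul (cg.pow 2)).mul cm)
    have integ2 : IntervalIntegrable
        (fun r => (w' r * (1 - ε ^ 2 / (w r + ε) ^ 2)) ^ 2 * m r) volume 0 R :=
      int ((cg'.pow 2).mul cm)
    have hle : ∫ r in (0:ℝ)..R, ((w' r * (1 - ε ^ 2 / (w r + ε) ^ 2)) ^ 2 * m r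
          - p * (U r * (w r ^ 2 / (w r + ε)) ^ 2 * m r)) ≤
        ∫ r in (0:ℝ)..R, ((w' r ^ 2 * m r - φ r * w r * m r)
          - (p * U r * w r - φ r) * w r * m r + ε * (2 * p * U r * w r * m r)) := by
      refine intervalIntegral.integral_mono_on hR.le (integ2.sub (integ1.const_mul p))
        (int (by fun_prop)) fun r hr => ?_
      have hm := hw.nonneg hr.1
      have hw0 := w0 r hr
      have hU0 : 0 ≤ p * U r := by
        have : 0 ≤ U r := Real.rpow_nonneg (abs_nonneg _) _
        positivity
      have hd : 0 < w r + ε := by linarith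
      have i1 : (w' r * (1 - ε ^ 2 / (w r + ε) ^ 2)) ^ 2 ≤ w' r ^ 2 := by
        have h1 : ε ^ 2 / (w r + ε) ^ 2 ≤ 1 := by
          rw [div_le_one (by positivity)]
          gcongr
          linarith
        have h2 : 0 ≤ ε ^ 2 / (w r + ε) ^ 2 := by positivity
        rw [mul_pow]
        exact mul_le_of_le_one_right (sq_nonneg _) (by nlinarith)
      have i2 : w r ^ 2 - 2 * ε * w r ≤ (w r ^ 2 / (w r + ε)) ^ 2 := by
        rw [div_pow, le_div_iff₀ (by positivity)]
        have : 0 ≤ 3 * ε ^ 2 * w r ^ 2 + 2 * ε ^ 3 * w r := by positivity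
        linarith [this, show (w r ^ 2) ^ 2 - (w r ^ 2 - 2 * ε * w r) * (w r + ε) ^ 2
          = 3 * ε ^ 2 * w r ^ 2 + 2 * ε ^ 3 * w r by ring]
      have i3 := mul_le_mul_of_nonneg_right i1 hm
      have i4 := mul_le_mul_of_nonneg_right (mul_le_mul_of_nonneg_left i2 hU0) hm
      linarith
    rw [intervalIntegral.integral_sub integ2 (integ1.const_mul p),
      intervalIntegral.integral_const_mul, intervalIntegral.integral_add (int (by fun_prop))
        (int (by fun_prop)), intervalIntegral.integral_sub (int (by fun_prop))
        (int (by fun_prop)), hT, intervalIntegral.integral_const_mul] at hle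
    linarith
  set J := ∫ r in (0:ℝ)..R, (p * U r * w r - φ r) * w r * m r
  set B := ∫ r in (0:ℝ)..R, 2 * p * U r * w r * m r
  have hB : 0 < |B| + 1 := by positivity
  have h1 := main (J / (2 * (|B| + 1))) (by positivity)
  have h2 : J / (2 * (|B| + 1)) * B ≤ J / (2 * (|B| + 1)) * (|B| + 1) := by
    have : B ≤ |B| + 1 := by linarith [le_abs_self B]
    gcongr
  have h3 : J / (2 * (|B| + 1)) * (|B| + 1) = J / 2 := by field_simp
  linarith

theorem RadialProfile.zero {p : ℝ} {k : ℝ → ℝ} : RadialProfile p k (fun _ => 0) (fun _ => 0) where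
  cont := continuousOn_const
  cont_deriv := continuousOn_const
  deriv_zero := rfl
  hasDeriv r _ := hasDerivAt_const r 0
  hasDeriv_deriv r _ := (hasDerivAt_const r (0:ℝ)).congr_deriv (by simp)

theorem WeightedStable.pos {p : ℝ} {m k u d : ℝ → ℝ} (hw : RadialWeight m k)
    (hp : 1 < p) (hu : RadialProfile p k u d) (hs : WeightedStable p m u) (h0 : 0 < u 0)
    {r : ℝ} (hr : 0 ≤ r) : 0 < u r := by
  by_contra hcon
  obtain ⟨R, hR, -, hz, hpos⟩ := exists_first_zero hu.cont h0 hr (not_lt.1 hcon)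
  exact hs.not_touch hw hp hu RadialProfile.zero hR (fun _ _ _ => le_rfl) hpos hz

/-- A profile lying below a positive one cannot vanish before the two meet. -/
theorem RadialProfile.pos_of_lt {p R : ℝ} {m k u d v e : ℝ → ℝ} (hw : RadialWeight m k)
    (hp : 1 < p) (hu : RadialProfile p k u d) (hv : RadialProfile p k v e)
    (hupos : ∀ r, 0 ≤ r → 0 < u r) (hv0 : 0 < v 0)
    (hlt : ∀ r, 0 ≤ r → r < R → v r < u r) {r : ℝ} (hr : 0 ≤ r) (hrR : r < R) : 0 < v r := by
  by_contra hcon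
  obtain ⟨S, hS, hSr, hz, hpos⟩ := exists_first_zero hv.cont hv0 hr (not_lt.1 hcon)
  have cm : ContinuousOn m (Icc 0 S) := hw.cont.mono Icc_subset_Ici_self
  have cu : ContinuousOn u (Icc 0 S) := hu.cont.mono Icc_subset_Ici_self
  have cd : ContinuousOn d (Icc 0 S) := hu.cont_deriv.mono Icc_subset_Ici_self
  have cv : ContinuousOn v (Icc 0 S) := hv.cont.mono Icc_subset_Ici_self
  have ce : ContinuousOn e (Icc 0 S) := hv.cont_deriv.mono Icc_subset_Ici_self
  have key := lt_of_hasDerivAt_pos (f := fun r => m r * e r * u r - m r * d r * v r)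
    (f' := fun r => m r * (u r * v r * (|u r| ^ (p - 1) - |v r| ^ (p - 1)))) hS (by fun_prop)
    (fun x hx => (((hw.hasDerivAt_flux hv hx.1).mul (hu.hasDeriv x hx.1)).sub
      ((hw.hasDerivAt_flux hu hx.1).mul (hv.hasDeriv x hx.1))).congr_deriv (by ring))
    (fun x hx => by
      have h1 := hpos x hx.1.le hx.2
      have h2 := hupos x hx.1.le
      have h3 := hlt x hx.1.le (hx.2.trans_le (hSr.trans hrR.le))
      have h4 : |v x| ^ (p - 1) < |u x| ^ (p - 1) := by
        rw [abs_of_pos h1, abs_of_pos h2]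
        exact Real.rpow_lt_rpow h1.le h3 (by linarith)
      exact mul_pos (hw.pos x hx.1) (mul_pos (mul_pos h2 h1) (sub_pos.2 h4)))
  have hd := hv.deriv_nonpos hw hpos hS.le le_rfl
  simp only [hw.zero, hz, mul_zero, zero_mul, sub_zero] at key
  have : m S * e S * u S ≤ 0 :=
    mul_nonpos_of_nonpos_of_nonneg (mul_nonpos_of_nonneg_of_nonpos (hw.pos S hS).le hd)
      (hupos S hS.le).le
  linarith

theorem WeightedStable.abs_le_of_lt {p : ℝ} {m k u d v e : ℝ → ℝ} (hw : RadialWeight m k)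
    (hp : 1 < p) (hu : RadialProfile p k u d) (hv : RadialProfile p k v e)
    (hs : WeightedStable p m u) (hv0 : 0 ≤ v 0) (hvu : v 0 < u 0) {r : ℝ} (hr : 0 ≤ r) :
    |v r| ≤ |u r| := by
  have hupos : ∀ r, 0 ≤ r → 0 < u r := fun r hr => hs.pos hw hp hu (hv0.trans_lt hvu) hr
  rcases hv0.eq_or_lt with h0 | h0
  · have := hv.abs_le hw.coeff_nonneg hp h0.symm le_rfl hr
    exact this.trans (abs_nonneg _)
  have hlt : ∀ r, 0 ≤ r → v r < u r := by
    intro r hr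
    by_contra hcon
    obtain ⟨R, hR, -, hz, hpos⟩ := exists_first_zero (w := fun r => u r - v r)
      (hu.cont.sub hv.cont) (sub_pos.2 hvu) hr (sub_nonpos.2 (not_lt.1 hcon))
    have heq : u R = v R := sub_eq_zero.1 hz
    refine hs.not_touch hw hp hu hv hR (fun s hs0 hsR => ?_)
      (fun s hs0 hsR => sub_pos.1 (hpos s hs0 hsR)) heq
    rcases hsR.lt_or_eq with h | h
    · exact (hu.pos_of_lt hw hp hv hupos h0 (fun s hs0 hsR => sub_pos.1 (hpos s hs0 hsR))
        hs0 h).le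
    · rw [h, ← heq]
      exact (hupos R hR.le).le
  have hvpos := hu.pos_of_lt (R := r + 1) hw hp hv hupos h0 (fun s hs _ => hlt s hs) hr
    (by linarith)
  rw [abs_of_pos hvpos, abs_of_pos (hupos r hr)]
  exact (hlt r hr).le

/-! ### Stability criteria -/

theorem weightedStable_of_le {p : ℝ} {m k u h : ℝ → ℝ} (hw : RadialWeight m k) (hp : 1 < p)
    (cu : ContinuousOn u (Ici 0)) (ch : ContinuousOn h (Ici 0))
    (hle : ∀ r > 0, |u r| ^ (p - 1) ≤ h r)
    (hst : ∀ χ : ℝ → ℝ, ContDiff ℝ 1 χ → HasCompactSupport χ →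
      p * ∫ r in Ioi (0:ℝ), h r * (χ r) ^ 2 * m r ≤ ∫ r in Ioi (0:ℝ), (deriv χ r) ^ 2 * m r) :
    WeightedStable p m u := by
  intro χ hχ hχs
  obtain ⟨R, hR, hz⟩ := exists_bound_of_hasCompactSupport hχs
  refine le_trans ?_ (hst χ hχ hχs)
  have cχ : ContinuousOn χ (Ici 0) := hχ.continuous.continuousOn
  refine mul_le_mul_of_nonneg_left ?_ (by linarith)
  refine setIntegral_mono_on
    (integrableOn_Ioi_of_eq_zero (((continuousOn_abs_rpow hp cu).mul (cχ.pow 2)).mul hw.cont)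
      hR.le fun r hr => ?_)
    (integrableOn_Ioi_of_eq_zero ((ch.mul (cχ.pow 2)).mul hw.cont) hR.le fun r hr => ?_)
    measurableSet_Ioi fun r hr => ?_
  · simp [(hz r hr.le).1]
  · simp [(hz r hr.le).1]
  · have := hw.nonneg (le_of_lt hr)
    have := hle r hr
    gcongr

theorem WeightedStable.of_lt {p : ℝ} {m k u d v e : ℝ → ℝ} (hw : RadialWeight m k)
    (hp : 1 < p) (hu : RadialProfile p k u d) (hv : RadialProfile p k v e)
    (hs : WeightedStable p m u) (hv0 : 0 ≤ v 0) (hvu : v 0 < u 0) : WeightedStable p m v :=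
  weightedStable_of_le hw hp hv.cont (continuousOn_abs_rpow hp hu.cont)
    (fun _ hr => Real.rpow_le_rpow (abs_nonneg _)
      (hs.abs_le_of_lt hw hp hu hv hv0 hvu (le_of_lt hr)) (by linarith)) hs

/-- Profiles with initial value below the threshold of a Poincaré inequality are stable. -/
theorem weightedStable_of_poincare {p K α : ℝ} {m k u d : ℝ → ℝ} (hw : RadialWeight m k)
    (hp : 1 < p) (hu : RadialProfile p k u d) (hK : 0 ≤ K)
    (hP : ∀ χ : ℝ → ℝ, ContDiff ℝ 1 χ → HasCompactSupport χ →
      K * ∫ r in Ioi (0:ℝ), (χ r) ^ 2 * m r ≤ ∫ r in Ioi (0:ℝ), (deriv χ r) ^ 2 * m r)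
    (h0 : u 0 = α) (hα : 0 ≤ α) (hαK : α ≤ (K / p) ^ (1 / (p - 1))) : WeightedStable p m u := by
  refine weightedStable_of_le hw hp hu.cont (h := fun _ => K / p) continuousOn_const
    (fun r hr => ?_) fun χ hχ hχs => ?_
  · have h1 := (hu.abs_le hw.coeff_nonneg hp h0 hα (le_of_lt hr)).trans hαK
    have hp1 : p - 1 ≠ 0 := by linarith
    calc |u r| ^ (p - 1) ≤ ((K / p) ^ (1 / (p - 1))) ^ (p - 1) :=
          Real.rpow_le_rpow (abs_nonneg _) h1 (by linarith)
      _ = K / p := by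
          rw [← Real.rpow_mul (by positivity), one_div_mul_cancel hp1, Real.rpow_one]
  · refine le_trans (le_of_eq ?_) (hP χ hχ hχs)
    simp_rw [mul_assoc]
    rw [integral_const_mul]
    field_simp

/-- Stability is closed under convergence of the initial values. -/
theorem weightedStable_of_tendsto {p α : ℝ} {m k u d : ℝ → ℝ} (hw : RadialWeight m k)
    (hp : 1 < p) (hu : RadialProfile p k u d) (h0 : u 0 = α) (hα : 0 ≤ α)
    (happ : ∀ η > 0, ∃ v e, RadialProfile p k v e ∧ WeightedStable p m v ∧
      0 ≤ v 0 ∧ v 0 ≤ α ∧ α - η < v 0) : WeightedStable p m u := by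
  intro χ hχ hχs
  obtain ⟨R, hR, hz⟩ := exists_bound_of_hasCompactSupport hχs
  have cχ : ContinuousOn χ (Ici 0) := hχ.continuous.continuousOn
  choose v e hv hst hv0 hvα hαv using fun N : ℕ => happ (1 / ((N:ℝ) + 1)) (by positivity)
  have hlim : ∀ r, 0 < r → Tendsto (fun N => v N r) atTop (nhds (u r)) := by
    intro r hr
    have hsq : Tendsto (fun N => (u r - v N r) ^ 2) atTop (nhds 0) := by
      refine squeeze_zero (fun _ => sq_nonneg _)
        (g := fun N : ℕ => exp ((p * α ^ (p - 1) + 1) * r) * (1 / ((N:ℝ) + 1)) ^ 2)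
        (fun N => ?_) ?_
      · refine (hu.sq_sub_le (hv N) hw.coeff_nonneg hp h0 rfl hα (hv0 N) le_rfl (hvα N)
          hr.le).trans ?_
        have h1 := hvα N
        have h2 := hαv N
        have : 0 ≤ α - v N 0 := by linarith
        gcongr
        linarith
      · have := ((tendsto_one_div_add_atTop_nhds_zero_nat (𝕜 := ℝ)).pow 2).const_mul
          (exp ((p * α ^ (p - 1) + 1) * r))
        simpa using this
    have habs : Tendsto (fun N => |u r - v N r|) atTop (nhds 0) := by
      have := (Real.continuous_sqrt.tendsto 0).comp hsq
      rw [Real.sqrt_zero] at this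
      exact this.congr fun N => Real.sqrt_sq_eq_abs _
    rw [tendsto_iff_dist_tendsto_zero]
    exact habs.congr fun N => by rw [Real.dist_eq, abs_sub_comm]
  have htend : Tendsto (fun N => ∫ r in Ioi (0:ℝ), |v N r| ^ (p - 1) * χ r ^ 2 * m r) atTop
      (nhds (∫ r in Ioi (0:ℝ), |u r| ^ (p - 1) * χ r ^ 2 * m r)) := by
    have integ : ∀ f : ℝ → ℝ, ContinuousOn f (Ici 0) →
        IntegrableOn (fun r => f r * χ r ^ 2 * m r) (Ioi 0) := fun f hf =>
      integrableOn_Ioi_of_eq_zero ((hf.mul (cχ.pow 2)).mul hw.cont) hR.le fun r hr => by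
        simp [(hz r hr.le).1]
    refine tendsto_integral_of_dominated_convergence (fun r => α ^ (p - 1) * χ r ^ 2 * m r)
      (fun N => (integ _ (continuousOn_abs_rpow hp (hv N).cont)).aestronglyMeasurable)
      (integ _ continuousOn_const) (fun N => ?_) ?_
    · refine (ae_restrict_iff' measurableSet_Ioi).2 (Eventually.of_forall fun r hr => ?_)
      have hm := hw.nonneg (le_of_lt hr)
      have h1 : |v N r| ≤ α :=
        ((hv N).abs_le hw.coeff_nonneg hp rfl (hv0 N) (le_of_lt hr)).trans (hvα N)
      have h2 : |v N r| ^ (p - 1) ≤ α ^ (p - 1) :=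
        Real.rpow_le_rpow (abs_nonneg _) h1 (by linarith)
      rw [Real.norm_of_nonneg (by positivity)]
      gcongr
    · refine (ae_restrict_iff' measurableSet_Ioi).2 (Eventually.of_forall fun r hr => ?_)
      exact ((((hlim r hr).abs).rpow_const (Or.inr (by linarith))).mul_const _).mul_const _
  exact le_of_tendsto' (htend.const_mul p) fun N => hst N χ hχ hχs

/-! ### Volume and the Poincaré inequality -/

theorem RadialWeight.exists_volume {m k : ℝ → ℝ} (hw : RadialWeight m k) :
    ∃ V : ℝ → ℝ, Continuous V ∧ V 0 = 0 ∧ ∀ r > 0, HasDerivAt V (m r) r := by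
  have hc : Continuous (fun r => m (max r 0)) :=
    hw.cont.comp_continuous (by fun_prop) fun r => le_max_right r 0
  have hd : ∀ r, HasDerivAt (fun r => ∫ t in (0:ℝ)..r, m (max t 0)) (m (max r 0)) r := fun r =>
    intervalIntegral.integral_hasDerivAt_right (hc.intervalIntegrable _ _)
      (hc.stronglyMeasurableAtFilter _ _) hc.continuousAt
  refine ⟨_, continuous_iff_continuousAt.2 fun r => (hd r).continuousAt, by simp, fun r hr => ?_⟩
  have := hd r
  rwa [max_eq_left (le_of_lt hr)] at this

theorem RadialWeight.exists_poincare {m k : ℝ → ℝ} (hw : RadialWeight m k) {c : ℝ} (hc : 0 < c)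
    (hk : ∀ᶠ r in atTop, c ≤ k r) :
    ∃ K > 0, ∀ χ : ℝ → ℝ, ContDiff ℝ 1 χ → HasCompactSupport χ →
      K * ∫ r in Ioi (0:ℝ), (χ r) ^ 2 * m r ≤ ∫ r in Ioi (0:ℝ), (deriv χ r) ^ 2 * m r := by
  obtain ⟨V, cV, V0, hV⟩ := hw.exists_volume
  obtain ⟨A, hA⟩ := eventually_atTop.1 hk
  set R₀ := max A 1
  have hR₀ : 0 < R₀ := lt_max_of_lt_right one_pos
  set C := R₀ + 1 / c with hC
  have hC0 : 0 < C := by positivity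
  have Vnonneg : ∀ r, 0 ≤ r → 0 ≤ V r := fun r hr => by
    have := le_of_hasDerivAt_nonneg hr cV.continuousOn (fun x hx => hV x hx.1)
      fun x hx => (hw.pos x hx.1).le
    rwa [V0] at this
  have Vle1 : ∀ r, 0 ≤ r → V r ≤ r * m r := fun r hr => by
    have cm : ContinuousOn m (Icc 0 r) := hw.cont.mono Icc_subset_Ici_self
    have := le_of_hasDerivAt_nonneg (f := fun x => x * m x - V x)
      (f' := fun x => x * (k x * m x)) hr
      ((continuousOn_id.mul cm).sub cV.continuousOn)
      (fun x hx => (((hasDerivAt_id x).mul (hw.hasDeriv x hx.1)).sub (hV x hx.1)).congr_deriv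
        (by simp))
      fun x hx => by
        have := hw.coeff_nonneg x hx.1
        have := hw.pos x hx.1
        have := hx.1
        positivity
    simp only [zero_mul, V0, sub_zero] at this
    linarith
  have Vle : ∀ r, 0 ≤ r → V r ≤ C * m r := fun r hr => by
    have hC1 : R₀ ≤ C := by rw [hC]; linarith [show 0 < 1 / c by positivity]
    rcases le_total r R₀ with h | h
    · exact (Vle1 r hr).trans (mul_le_mul_of_nonneg_right (h.trans hC1) (hw.nonneg hr))
    · have cm : ContinuousOn m (Icc R₀ r) := hw.cont.mono fun x hx => hR₀.le.trans hx.1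
      have := le_of_hasDerivAt_nonneg (f := fun x => C * m x - V x)
        (f' := fun x => C * (k x * m x) - m x) h
        ((continuousOn_const.mul cm).sub cV.continuousOn)
        (fun x hx => ((hw.hasDeriv x (hR₀.trans hx.1)).const_mul C).sub
          (hV x (hR₀.trans hx.1)))
        fun x hx => by
          have h1 : c ≤ k x := hA x ((le_max_left _ _).trans hx.1.le)
          have h2 := hw.pos x (hR₀.trans hx.1)
          have h3 : 1 ≤ C * c := by
            rw [hC, add_mul, one_div_mul_cancel hc.ne']
            linarith [mul_pos hR₀ hc]
          have h4 : 1 ≤ C * k x := h3.trans (by gcongr)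
          nlinarith
      have h5 := (Vle1 R₀ hR₀.le).trans (mul_le_mul_of_nonneg_right hC1 (hw.nonneg hR₀.le))
      linarith
  refine ⟨1 / (4 * C ^ 2), by positivity, fun χ hχ hχs => ?_⟩
  obtain ⟨R, hR, hz⟩ := exists_bound_of_hasCompactSupport hχs
  rw [setIntegral_Ioi_of_eq_zero (R := R) hR.le fun r hr => by simp [(hz r hr.le).1],
    setIntegral_Ioi_of_eq_zero (R := R) hR.le fun r hr => by simp [(hz r hr.le).2]]
  have cm : ContinuousOn m (Icc 0 R) := hw.cont.mono Icc_subset_Ici_self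
  have cχ : ContinuousOn χ (Icc 0 R) := hχ.continuous.continuousOn
  have cχ' : ContinuousOn (deriv χ) (Icc 0 R) := (contDiff_one_continuous_deriv hχ).continuousOn
  have cV' : ContinuousOn V (Icc 0 R) := cV.continuousOn
  have int : ∀ {F : ℝ → ℝ}, ContinuousOn F (Icc 0 R) → IntervalIntegrable F volume 0 R :=
    fun hF => hF.intervalIntegrable_of_Icc hR.le
  have hT : ∫ r in (0:ℝ)..R, (2 * χ r * deriv χ r * V r + χ r ^ 2 * m r) = 0 := by
    rw [intervalIntegral.integral_eq_sub_of_hasDerivAt_of_le (f := fun r => χ r ^ 2 * V r) hR.le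
      (by fun_prop) (fun x hx => ?_) (int (by fun_prop)), V0, (hz R le_rfl).1]
    · ring
    · have h1 := ((hχ.differentiable one_ne_zero).differentiableAt (x := x)).hasDerivAt
      refine ((h1.pow 2).mul (hV x hx.1)).congr_deriv ?_
      simp only [Pi.pow_apply]
      push_cast
      ring
  have hle : ∫ r in (0:ℝ)..R, (1 / 2 * (χ r ^ 2 * m r) - 2 * C ^ 2 * (deriv χ r ^ 2 * m r)) ≤
      ∫ r in (0:ℝ)..R, (2 * χ r * deriv χ r * V r + χ r ^ 2 * m r) := by
    refine intervalIntegral.integral_mono_on hR.le (int (by fun_prop)) (int (by fun_prop))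
      fun r hr => ?_
    have h1 := Vle r hr.1
    have h2 := Vnonneg r hr.1
    set a := χ r
    set b := deriv χ r
    have h3 : -(4 * C * a * b * V r) ≤ C * m r * (a ^ 2 + 4 * C ^ 2 * b ^ 2) :=
      calc -(4 * C * a * b * V r) ≤ V r * (a ^ 2 + 4 * C ^ 2 * b ^ 2) := by
            nlinarith [mul_nonneg h2 (sq_nonneg (a + 2 * C * b))]
        _ ≤ _ := by gcongr
    have h4 : C * (-(2 * a * b * V r)) ≤ C * (m r * (a ^ 2 + 4 * C ^ 2 * b ^ 2) / 2) := by
      linarith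
    have h5 := le_of_mul_le_mul_left h4 hC0
    linarith
  rw [hT, intervalIntegral.integral_sub (int (by fun_prop)) (int (by fun_prop)),
    intervalIntegral.integral_const_mul, intervalIntegral.integral_const_mul] at hle
  rw [div_mul_eq_mul_div, one_mul, div_le_iff₀ (by positivity)]
  linarith

/-! ### Instability for large initial values -/

theorem exists_joseph_lundgren_exponent {n : ℕ} {p : ℝ} (hp : 1 < p)
    (hnp : n ≤ 10 ∨ (11 ≤ n ∧ p < pJL n)) :
    ∃ γ > 0, (γ + 1) ^ 2 < 4 * γ * p ∧ (n : ℝ) * (p - 1) < 2 * (p + γ) := by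
  set σ := √(p * (p - 1)) with hσ
  have hσ0 : 0 < σ := Real.sqrt_pos.2 (mul_pos (by linarith) (by linarith))
  have hσ2 : σ ^ 2 = p * (p - 1) :=
    Real.sq_sqrt (mul_nonneg (by linarith) (by linarith))
  have gap : (n : ℝ) * (p - 1) < 2 * (3 * p - 1 + 2 * σ) := by
    rcases hnp with h | ⟨h, hpn⟩
    · have hN : (n : ℝ) ≤ 10 := by exact_mod_cast h
      have : p - 2 < σ := by
        by_contra hcon
        rw [not_lt] at hcon
        nlinarith
      nlinarith
    · have hN : (11 : ℝ) ≤ n := by exact_mod_cast h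
      set N : ℝ := (n : ℝ)
      set s := √(N - 1) with hs
      have hs2 : s ^ 2 = N - 1 := Real.sq_sqrt (by linarith)
      have hs3 : 3 ≤ s := Real.le_sqrt_of_sq_le (by linarith)
      have ha : 0 < (N - 2) * (N - 10) := mul_pos (by linarith) (by linarith)
      unfold pJL at hpn
      rw [lt_div_iff₀ ha] at hpn
      by_contra hcon
      rw [not_lt] at hcon
      have hL : 4 * σ ≤ (N - 6) * p - (N - 2) := by linarith
      have hsq : 16 * (p * (p - 1)) ≤ ((N - 6) * p - (N - 2)) ^ 2 := by
        rw [← hσ2]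
        nlinarith
      set A := p * ((N - 2) * (N - 10)) - ((N - 2) ^ 2 - 4 * N) with hA
      have hQ : 0 ≤ (N - 2) * (N - 10) *
          (((N - 6) * p - (N - 2)) ^ 2 - 16 * (p * (p - 1))) :=
        mul_nonneg ha.le (by linarith)
      have hA2 : (8 * s) ^ 2 ≤ A ^ 2 := by
        have : A ^ 2 - (8 * s) ^ 2 = (N - 2) * (N - 10) *
          (((N - 6) * p - (N - 2)) ^ 2 - 16 * (p * (p - 1))) := by
          rw [mul_pow, hs2, hA]
          ring
        linarith
      have hA3 : A < 8 * s := by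
        change _ < _ + 8 * s at hpn
        linarith
      have hA4 : A ≤ -(8 * s) := by
        by_contra hcon2
        rw [not_le] at hcon2
        nlinarith
      have h1 : 0 ≤ (N - 6) * p - (N - 2) := by linarith
      have h2 : (N - 6) * A = (N - 2) * (N - 10) * ((N - 6) * p - (N - 2)) - 8 * N - 16 := by
        rw [hA]
        ring
      have h3 : -(8 * N) - 16 ≤ (N - 6) * A := by
        rw [h2]
        linarith [mul_nonneg ha.le h1]
      nlinarith
  set g := 2 * (3 * p - 1 + 2 * σ) - n * (p - 1) with hg
  have hg0 : 0 < g := by linarith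
  set t := min σ (g / 8) with ht
  have ht0 : 0 < t := lt_min hσ0 (by positivity)
  have ht1 : t ≤ σ := min_le_left _ _
  have ht2 : t ≤ g / 8 := min_le_right _ _
  refine ⟨2 * p - 1 + 2 * (σ - t), by linarith, ?_, by linarith⟩
  nlinarith

/-- A `C¹` cutoff equal to `1` up to `2` and to `0` from `3` on. -/
theorem exists_cutoff : ∃ η : ℝ → ℝ, ContDiff ℝ 1 η ∧ (∀ r ≤ 2, η r = 1 ∧ deriv η r = 0) ∧
    ∀ r, 3 ≤ r → η r = 0 ∧ deriv η r = 0 := by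
  have hC : ContDiff ℝ 1 (fun r : ℝ => Real.smoothTransition (3 - r)) :=
    Real.smoothTransition.contDiff.comp (contDiff_const.sub contDiff_id)
  have hc := contDiff_one_continuous_deriv hC
  refine ⟨_, hC, fun r hr => ⟨Real.smoothTransition.one_of_one_le (by linarith), ?_⟩,
    fun r hr => ⟨Real.smoothTransition.zero_of_nonpos (by linarith), ?_⟩⟩
  · have hcl : IsClosed {r : ℝ | deriv (fun r : ℝ => Real.smoothTransition (3 - r)) r = 0} :=
      isClosed_eq hc continuous_const
    have hsub : Iio (2 : ℝ) ⊆
        {r : ℝ | deriv (fun r : ℝ => Real.smoothTransition (3 - r)) r = 0} := fun x hx => by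
      have : (fun r : ℝ => Real.smoothTransition (3 - r)) =ᶠ[nhds x] fun _ => 1 := by
        filter_upwards [Iio_mem_nhds hx] with y hy
        exact Real.smoothTransition.one_of_one_le (by linarith [mem_Iio.1 hy])
      exact this.deriv_eq.trans (deriv_const _ _)
    have := hcl.closure_subset_iff.2 hsub
    rw [closure_Iio] at this
    exact this hr
  · have hcl : IsClosed {r : ℝ | deriv (fun r : ℝ => Real.smoothTransition (3 - r)) r = 0} :=
      isClosed_eq hc continuous_const
    have hsub : Ioi (3 : ℝ) ⊆
        {r : ℝ | deriv (fun r : ℝ => Real.smoothTransition (3 - r)) r = 0} := fun x hx => by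
      have : (fun r : ℝ => Real.smoothTransition (3 - r)) =ᶠ[nhds x] fun _ => 0 := by
        filter_upwards [Ioi_mem_nhds hx] with y hy
        exact Real.smoothTransition.zero_of_nonpos (by linarith [mem_Ioi.1 hy])
      exact this.deriv_eq.trans (deriv_const _ _)
    have := hcl.closure_subset_iff.2 hsub
    rw [closure_Ioi] at this
    exact this hr

theorem RadialProfile.antitone_of_pos {p : ℝ} {m k u d : ℝ → ℝ} (hw : RadialWeight m k)
    (hu : RadialProfile p k u d) (hpos : ∀ r, 0 ≤ r → 0 < u r) {r s : ℝ} (hr : 0 ≤ r)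
    (hrs : r ≤ s) : u s ≤ u r :=
  le_of_hasDerivAt_nonpos hrs (hu.cont.mono fun _ hx => hr.trans hx.1)
    (fun x hx => hu.hasDeriv x (hr.trans_lt hx.1))
    fun x hx => hu.deriv_nonpos (R := x + 1) hw (fun r hr _ => hpos r hr)
      (hr.trans hx.1.le) (by linarith)

/-- Positive profiles are bounded away from the origin independently of the initial value. -/
theorem RadialWeight.exists_bound_pos_profile {p : ℝ} {m k : ℝ → ℝ} (hw : RadialWeight m k)
    (hp : 1 < p) : ∃ B > 0, ∀ u d, RadialProfile p k u d → (∀ r, 0 ≤ r → 0 < u r) →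
      ∀ r, 2 ≤ r → u r ≤ B := by
  obtain ⟨V, cV, V0, hV⟩ := hw.exists_volume
  have V1 : 0 < V 1 := by
    have := lt_of_hasDerivAt_pos one_pos cV.continuousOn (fun x hx => hV x hx.1)
      fun x hx => hw.pos x hx.1
    rwa [V0] at this
  have hm2 := hw.pos 2 two_pos
  set c := V 1 / m 2 with hc
  have hc0 : 0 < c := by positivity
  have hp1 : 0 < p - 1 := by linarith
  refine ⟨((p - 1) * c) ^ (1 / (1 - p)), by positivity, fun u d hu hpos r hr => ?_⟩
  refine (hu.antitone_of_pos hw hpos zero_le_two hr).trans ?_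
  have hd : ∀ r, 1 < r → r < 2 → d r ≤ -(c * (u r ^ (p - 1) * u r)) := by
    intro r h1 h2
    have hr0 : 0 < r := one_pos.trans h1
    have hur := hpos r hr0.le
    have key := le_of_hasDerivAt_nonpos (f := fun x => m x * d x + u r ^ (p - 1) * u r * V x)
      (f' := fun x => -(m x * (|u x| ^ (p - 1) * u x)) + u r ^ (p - 1) * u r * m x) hr0.le
      (((hw.cont.mono Icc_subset_Ici_self).mul
        (hu.cont_deriv.mono Icc_subset_Ici_self)).add (continuousOn_const.mul cV.continuousOn))
      (fun x hx => (hw.hasDerivAt_flux hu hx.1).add ((hV x hx.1).const_mul _))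
      (fun x hx => by
        have h3 := hu.antitone_of_pos hw hpos hx.1.le hx.2.le
        have hux := hpos x hx.1.le
        have h4 : u r ^ (p - 1) * u r ≤ u x ^ (p - 1) * u x := by gcongr
        rw [abs_of_pos (hpos x hx.1.le)]
        have := mul_le_mul_of_nonneg_right h4 (hw.pos x hx.1).le
        linarith)
    simp only [hw.zero, V0, zero_mul, mul_zero, add_zero] at key
    have hV1 : V 1 ≤ V r := le_of_hasDerivAt_nonneg h1.le cV.continuousOn
      (fun x hx => hV x (one_pos.trans hx.1)) fun x hx => (hw.pos x (one_pos.trans hx.1)).le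
    have hmr : m r ≤ m 2 := hw.mono hr0.le h2.le
    have hm0 := hw.pos r hr0
    have hq : 0 < u r ^ (p - 1) * u r := by positivity
    have h5 : c * m r ≤ V r := by
      calc c * m r ≤ c * m 2 := by gcongr
        _ = V 1 := by rw [hc]; field_simp
        _ ≤ V r := hV1
    have h6 := mul_le_mul_of_nonneg_left h5 hq.le
    refine le_of_mul_le_mul_left ?_ hm0
    linarith
  have key := le_of_hasDerivAt_nonneg (f := fun x => u x ^ (1 - p) - (p - 1) * c * x)
    (f' := fun x => d x * (1 - p) * u x ^ (1 - p - 1) - (p - 1) * c) one_le_two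
    (((hu.cont.mono fun x hx => zero_le_one.trans hx.1).rpow_const fun x hx =>
      Or.inl (hpos x (zero_le_one.trans hx.1)).ne').sub (by fun_prop))
    (fun x hx => ((hu.hasDeriv x (one_pos.trans hx.1)).rpow_const
      (Or.inl (hpos x (one_pos.trans hx.1).le).ne')).sub
        (((hasDerivAt_id x).const_mul _).congr_deriv (by ring)))
    (fun x hx => by
      have hux := hpos x (one_pos.trans hx.1).le
      have h1 := hd x hx.1 hx.2
      have h2 : (u x ^ (p - 1) * u x) * u x ^ (1 - p - 1) = 1 := by
        rw [← Real.rpow_add_one hux.ne', ← Real.rpow_add hux]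
        ring_nf
        exact Real.rpow_zero _
      have h3 : 0 ≤ (p - 1) * u x ^ (1 - p - 1) := by positivity
      have h4 := mul_le_mul_of_nonneg_right h1 h3
      have h5 : -(c * (u x ^ (p - 1) * u x)) * ((p - 1) * u x ^ (1 - p - 1))
          = -(c * (p - 1)) := by
        linear_combination (-(c * (p - 1))) * h2
      rw [h5] at h4
      linarith)
  have hu1 : 0 < u 1 ^ (1 - p) := Real.rpow_pos_of_pos (hpos 1 zero_le_one) _
  have hu2 := hpos 2 zero_le_two
  have h2 : (p - 1) * c ≤ u 2 ^ (1 - p) := by linarith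
  have hp2 : 1 - p ≠ 0 := by linarith
  calc u 2 = (u 2 ^ (1 - p)) ^ (1 / (1 - p)) := by
        rw [← Real.rpow_mul hu2.le, mul_one_div_cancel hp2, Real.rpow_one]
    _ ≤ _ := Real.rpow_le_rpow_of_nonpos (by positivity) h2
        (one_div_nonpos.2 (by linarith))

/-- Farina's integral estimate: stable profiles obey an interior bound that is independent of
the initial value. -/
theorem RadialWeight.exists_bound_integral {p γ : ℝ} {m k : ℝ → ℝ} (hw : RadialWeight m k)
    (hp : 1 < p) (hγ : 0 < γ) (hγp : (γ + 1) ^ 2 < 4 * γ * p) :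
    ∃ K, ∀ u d, RadialProfile p k u d → WeightedStable p m u → 0 < u 0 →
      ∀ a b, 0 ≤ a → a ≤ b → b ≤ 2 → ∫ r in a..b, u r ^ (p + γ) * m r ≤ K := by
  obtain ⟨B, hB, hbound⟩ := hw.exists_bound_pos_profile hp
  obtain ⟨η, hη, hη2, hη3⟩ := exists_cutoff
  obtain ⟨E, hE⟩ := (isCompact_Icc (a := (0:ℝ)) (b := 3)).exists_bound_of_continuousOn
    (contDiff_one_continuous_deriv hη).continuousOn
  set s := (γ + 1) / 2 with hs
  have hs0 : 0 < s := by positivity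
  have hsγ : s ^ 2 < γ * p := by rw [hs]; linarith
  obtain ⟨l, hl1, hl2⟩ : ∃ l, s ^ 2 < l * γ ∧ l < p := by
    obtain ⟨l, h1, h2⟩ := exists_between (show s ^ 2 / γ < p by
      rw [div_lt_iff₀ hγ]; linarith)
    exact ⟨l, by rwa [div_lt_iff₀ hγ] at h1, h2⟩
  have hμ : 0 < l * γ - s ^ 2 := by linarith
  set D := 1 + (l - s) ^ 2 / (l * γ - s ^ 2) with hD
  refine ⟨D * (3 * ((B ^ s) ^ 2 * E ^ 2 * m 3)) / (p - l),
    fun u d hu hst h0 a b ha hab hb => ?_⟩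
  have hpos : ∀ r, 0 ≤ r → 0 < u r := fun r hr => hst.pos hw hp hu h0 hr
  have cm : ContinuousOn m (Icc 0 3) := hw.cont.mono Icc_subset_Ici_self
  have cu : ContinuousOn u (Icc 0 3) := hu.cont.mono Icc_subset_Ici_self
  have cd : ContinuousOn d (Icc 0 3) := hu.cont_deriv.mono Icc_subset_Ici_self
  have cη : ContinuousOn η (Icc 0 3) := hη.continuous.continuousOn
  have cη' : ContinuousOn (deriv η) (Icc 0 3) := (contDiff_one_continuous_deriv hη).continuousOn
  have cpow : ∀ q : ℝ, ContinuousOn (fun r => u r ^ q) (Icc 0 3) := fun q =>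
    cu.rpow_const fun r hr => Or.inl (hpos r hr.1).ne'
  have dη : ∀ r, HasDerivAt η (deriv η r) r := fun r =>
    ((hη.differentiable one_ne_zero).differentiableAt (x := r)).hasDerivAt
  have int : ∀ {F : ℝ → ℝ}, ContinuousOn F (Icc 0 3) → IntervalIntegrable F volume 0 3 :=
    fun hF => hF.intervalIntegrable_of_Icc (by norm_num)
  set S : ℝ → ℝ := fun r => u r ^ (s - 1) with hS
  set P : ℝ → ℝ := fun r => u r ^ (p - 1) with hP
  have cS : ContinuousOn S (Icc 0 3) := cpow _
  have cP : ContinuousOn P (Icc 0 3) := cpow _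
  have eS : ∀ r, 0 ≤ r → u r ^ s = S r * u r := fun r hr => by
    rw [hS, ← Real.rpow_add_one (hpos r hr).ne']
    congr 1; ring
  have eγ1 : ∀ r, 0 ≤ r → u r ^ (γ - 1) = S r ^ 2 := fun r hr => by
    rw [hS, ← Real.rpow_natCast, ← Real.rpow_mul (hpos r hr).le]
    congr 1; push_cast; rw [hs]; ring
  have eγ : ∀ r, 0 ≤ r → u r ^ γ = S r ^ 2 * u r := fun r hr => by
    rw [← eγ1 r hr, ← Real.rpow_add_one (hpos r hr).ne']
    congr 1; ring
  have eZ : ∀ r, 0 ≤ r → u r ^ (p + γ) = P r * S r ^ 2 * u r ^ 2 := fun r hr => by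
    have : p + γ = (p - 1) + γ + 1 := by ring
    rw [this, Real.rpow_add_one (hpos r hr).ne', Real.rpow_add (hpos r hr), eγ r hr]
    ring
  have test := hst.intervalIntegral_le (R := 3) (g := fun r => u r ^ s * η r)
    (g' := fun r => s * S r * d r * η r + u r ^ s * deriv η r) (by norm_num)
    ((cpow s).mul cη)
    ((((continuousOn_const.mul cS).mul cd).mul cη).add ((cpow s).mul cη'))
    (fun r hr => (((hu.hasDeriv r hr.1).rpow_const (p := s) (Or.inl (hpos r hr.1.le).ne')).mul
      (dη r)).congr_deriv (by simp only [hS]; ring))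
    (by simp only [hu.deriv_zero, (hη2 0 (by norm_num)).2]; ring)
    (by simp only [(hη3 3 le_rfl).1, (hη3 3 le_rfl).2]; ring)
    (by simp only [(hη3 3 le_rfl).1]; ring)
  have e1 : ∫ r in (0:ℝ)..3, |u r| ^ (p - 1) * (u r ^ s * η r) ^ 2 * m r =
      ∫ r in (0:ℝ)..3, P r * (S r * u r * η r) ^ 2 * m r := by
    refine intervalIntegral.integral_congr fun r hr => ?_
    rw [uIcc_of_le (by norm_num)] at hr
    simp only [eS r hr.1, abs_of_pos (hpos r hr.1), hP]
  have e2 : ∫ r in (0:ℝ)..3, (s * S r * d r * η r + u r ^ s * deriv η r) ^ 2 * m r =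
      ∫ r in (0:ℝ)..3, (s * S r * d r * η r + S r * u r * deriv η r) ^ 2 * m r := by
    refine intervalIntegral.integral_congr fun r hr => ?_
    rw [uIcc_of_le (by norm_num)] at hr
    simp only [eS r hr.1]
  rw [e1, e2, ← intervalIntegral.integral_const_mul] at test
  have hT : ∫ r in (0:ℝ)..3, (-(P r * (S r * u r * η r) ^ 2) + γ * (S r * d r * η r) ^ 2
      + 2 * (S r * d r * η r) * (S r * u r * deriv η r)) * m r = 0 := by
    rw [intervalIntegral.integral_eq_sub_of_hasDerivAt_of_le
      (f := fun r => m r * d r * (u r ^ γ * η r ^ 2)) (by norm_num)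
      ((cm.mul cd).mul ((cpow γ).mul (cη.pow 2))) (fun r hr => ?_) (int (by fun_prop)), hw.zero,
      (hη3 3 le_rfl).1]
    · ring
    · refine ((hw.hasDerivAt_flux hu hr.1).mul (((hu.hasDeriv r hr.1).rpow_const (p := γ)
        (Or.inl (hpos r hr.1.le).ne')).mul ((dη r).pow 2))).congr_deriv ?_
      simp only [Pi.mul_apply, Pi.pow_apply, abs_of_pos (hpos r hr.1.le), eγ r hr.1.le,
        eγ1 r hr.1.le, hP]
      push_cast
      ring
  have main : ∫ r in (0:ℝ)..3, ((p - l) * (P r * (S r * u r * η r) ^ 2 * m r)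
        - D * ((S r * u r * deriv η r) ^ 2 * m r)) ≤
      ∫ r in (0:ℝ)..3, (p * (P r * (S r * u r * η r) ^ 2 * m r)
        - (s * S r * d r * η r + S r * u r * deriv η r) ^ 2 * m r
        + l * ((-(P r * (S r * u r * η r) ^ 2) + γ * (S r * d r * η r) ^ 2
          + 2 * (S r * d r * η r) * (S r * u r * deriv η r)) * m r)) := by
    refine intervalIntegral.integral_mono_on (by norm_num) (int (by fun_prop))
      (int (by fun_prop)) fun r hr => ?_
    have hm := hw.nonneg hr.1
    set X := S r * d r * η r
    set Y := S r * u r * deriv η r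
    set Z := P r * (S r * u r * η r) ^ 2
    have hq : 0 ≤ (l * γ - s ^ 2) * (X + (l - s) / (l * γ - s ^ 2) * Y) ^ 2 := by positivity
    have hq2 : (l * γ - s ^ 2) * (X + (l - s) / (l * γ - s ^ 2) * Y) ^ 2 =
        (l * γ - s ^ 2) * X ^ 2 + 2 * (l - s) * X * Y + (D - 1) * Y ^ 2 := by
      rw [hD]
      field_simp
      ring
    rw [hq2] at hq
    have hX : s * S r * d r * η r = s * X := by simp only [X]; ring
    rw [hX]
    have := mul_nonneg hq hm
    linarith
  rw [intervalIntegral.integral_add (int (by fun_prop)) (int (by fun_prop)),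
    intervalIntegral.integral_sub (int (by fun_prop)) (int (by fun_prop)),
    intervalIntegral.integral_sub (int (by fun_prop)) (int (by fun_prop)),
    intervalIntegral.integral_const_mul l, hT, intervalIntegral.integral_const_mul (p - l),
    intervalIntegral.integral_const_mul D] at main
  have hY : ∫ r in (0:ℝ)..3, (S r * u r * deriv η r) ^ 2 * m r
      ≤ 3 * ((B ^ s) ^ 2 * E ^ 2 * m 3) := by
    have := intervalIntegral.integral_mono_on (a := (0:ℝ)) (b := 3)
      (f := fun r => (S r * u r * deriv η r) ^ 2 * m r)
      (g := fun _ => (B ^ s) ^ 2 * E ^ 2 * m 3) (by norm_num) (int (by fun_prop))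
      (int continuousOn_const) fun r hr => by
        have hm3 := hw.mono hr.1 hr.2
        have hm := hw.nonneg hr.1
        have hm3' := hm.trans hm3
        rcases le_total r 2 with h | h
        · simp only [(hη2 r h).2]
          rw [mul_zero]
          simp only [ne_eq, OfNat.ofNat_ne_zero, not_false_eq_true, zero_pow, zero_mul]
          positivity
        · have h1 : u r ^ s ≤ B ^ s :=
            Real.rpow_le_rpow (hpos r hr.1).le (hbound u d hu hpos r h) hs0.le
          have h2 : deriv η r ^ 2 ≤ E ^ 2 := sq_le_sq' (abs_le.1 (hE r hr)).1
            (abs_le.1 (hE r hr)).2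
          have h3 : 0 ≤ u r ^ s := Real.rpow_nonneg (hpos r hr.1).le _
          rw [mul_pow, ← eS r hr.1]
          gcongr
    rw [intervalIntegral.integral_const, smul_eq_mul, sub_zero] at this
    exact this
  have hD0 : 0 ≤ D := by positivity
  have hZ : ∫ r in (0:ℝ)..3, P r * (S r * u r * η r) ^ 2 * m r
      ≤ D * (3 * ((B ^ s) ^ 2 * E ^ 2 * m 3)) / (p - l) := by
    rw [le_div_iff₀ (by linarith)]
    have := mul_le_mul_of_nonneg_left hY hD0
    linarith
  refine le_trans ?_ hZ
  calc ∫ r in a..b, u r ^ (p + γ) * m r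
      = ∫ r in a..b, P r * (S r * u r * η r) ^ 2 * m r := by
        refine intervalIntegral.integral_congr fun r hr => ?_
        rw [uIcc_of_le hab] at hr
        simp only [eZ r (ha.trans hr.1), (hη2 r (hr.2.trans hb)).1]
        ring
    _ ≤ _ := by
        refine intervalIntegral.integral_mono_interval ha hab (by linarith) ?_ (int (by fun_prop))
        refine (ae_restrict_iff' measurableSet_Ioc).2 (Eventually.of_forall fun r hr => ?_)
        have hm := hw.nonneg hr.1.le
        have : 0 ≤ P r := Real.rpow_nonneg (hpos r hr.1.le).le _
        simp only [Pi.zero_apply]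
        positivity

theorem RadialProfile.half_le {p α : ℝ} {m k u d : ℝ → ℝ} (hw : RadialWeight m k) (hp : 1 < p)
    (hu : RadialProfile p k u d) (hpos : ∀ r, 0 ≤ r → 0 < u r) (h0 : u 0 = α) {r : ℝ}
    (hr : 0 ≤ r) (hrα : r ≤ α ^ ((1 - p) / 2)) : α / 2 ≤ u r := by
  have hα : 0 < α := h0 ▸ hpos 0 le_rfl
  have hA : α ^ (p - 1) * α * (α ^ ((1 - p) / 2)) ^ 2 = α := by
    rw [← Real.rpow_natCast, ← Real.rpow_mul hα.le, ← Real.rpow_add_one hα.ne',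
      ← Real.rpow_add hα]
    push_cast
    ring_nf
    exact Real.rpow_one _
  set A := α ^ (p - 1) * α with hAdef
  have hA0 : 0 ≤ A := by positivity
  have hd : ∀ x, 0 ≤ x → -(A * x) ≤ d x := fun x hx => by
    have := le_of_hasDerivAt_nonneg (f := fun x => d x + A * x)
      (f' := fun x => -(k x * d x) - |u x| ^ (p - 1) * u x + A) hx
      ((hu.cont_deriv.mono Icc_subset_Ici_self).add (by fun_prop))
      (fun y hy => (hu.hasDeriv_deriv y hy.1).add
        (((hasDerivAt_id y).const_mul A).congr_deriv (by ring)))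
      fun y hy => by
        have h1 := hu.deriv_nonpos (R := y + 1) hw (fun r hr _ => hpos r hr) hy.1.le
          (by linarith)
        have h2 := mul_nonpos_of_nonneg_of_nonpos (hw.coeff_nonneg y hy.1) h1
        have h3 : u y ≤ α := h0 ▸ hu.antitone_of_pos hw hpos le_rfl hy.1.le
        have h4 := hpos y hy.1.le
        have h5 : |u y| ^ (p - 1) * u y ≤ A := by
          rw [abs_of_pos h4, hAdef]
          have : 0 ≤ p - 1 := by linarith
          gcongr
        linarith
    simp only [hu.deriv_zero, mul_zero, add_zero] at this
    linarith
  have key := le_of_hasDerivAt_nonneg (f := fun x => u x + A * x ^ 2 / 2)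
    (f' := fun x => d x + A * x) hr ((hu.cont.mono Icc_subset_Ici_self).add (by fun_prop))
    (fun y hy => (hu.hasDeriv y hy.1).add
      (((((hasDerivAt_id y).pow 2).const_mul A).div_const 2).congr_deriv (by
        simp only [id]; push_cast; ring)))
    fun y hy => by linarith [hd y hy.1.le]
  simp only [h0] at key
  have h1 : A * r ^ 2 ≤ A * (α ^ ((1 - p) / 2)) ^ 2 := by gcongr
  nlinarith

theorem RadialWeight.exists_bound_stable {n : ℕ} {p δ : ℝ} {m k : ℝ → ℝ}
    (hw : RadialWeight m k) (hn : 3 ≤ n) (hp : 1 < p)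
    (hnp : n ≤ 10 ∨ (11 ≤ n ∧ p < pJL n)) (hδ : 0 < δ)
    (hm : ∀ r, 0 ≤ r → r ≤ δ → (r / 2) ^ (n - 1) ≤ m r) :
    ∃ A, ∀ u d, RadialProfile p k u d → WeightedStable p m u → u 0 ≤ A := by
  obtain ⟨γ, hγ, hγp, hγn⟩ := exists_joseph_lundgren_exponent hp hnp
  obtain ⟨K, hK⟩ := hw.exists_bound_integral hp hγ hγp
  have t1 : Tendsto (fun α : ℝ => α ^ ((1 - p) / 2)) atTop (nhds 0) := by
    have := tendsto_rpow_neg_atTop (y := (p - 1) / 2) (by linarith)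
    refine this.congr fun α => ?_
    congr 1
    ring
  have t2 : Tendsto (fun α : ℝ => (1 / 2) ^ (p + γ) * (1 / 4) ^ (n - 1) * (1 / 2) *
      α ^ (p + γ + (1 - p) / 2 * n)) atTop atTop :=
    (tendsto_rpow_atTop (by linarith)).const_mul_atTop (by positivity)
  obtain ⟨A, hA⟩ := eventually_atTop.1 ((t1.eventually_lt_const (lt_min hδ one_pos)).and
    (t2.eventually_gt_atTop K))
  refine ⟨max A 0, fun u d hu hs => ?_⟩
  by_contra hcon
  rw [not_le, max_lt_iff] at hcon
  obtain ⟨hα1, hα2⟩ := hA (u 0) hcon.1.le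
  set α := u 0 with hα
  have hα0 : 0 < α := hcon.2
  set ρ := α ^ ((1 - p) / 2) with hρ
  have hρ0 : 0 < ρ := Real.rpow_pos_of_pos hα0 _
  have hρδ : ρ < δ := hα1.trans_le (min_le_left _ _)
  have hρ1 : ρ < 1 := hα1.trans_le (min_le_right _ _)
  have hpos : ∀ r, 0 ≤ r → 0 < u r := fun r hr => hs.pos hw hp hu hα0 hr
  have hup := hK u d hu hs hα0 (ρ / 2) ρ (by positivity) (by linarith) (by linarith)
  have hsub : Icc (ρ / 2) ρ ⊆ Ici 0 := fun x hx => (half_pos hρ0).le.trans hx.1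
  have hlow := intervalIntegral.integral_mono_on (a := ρ / 2) (b := ρ)
    (f := fun _ => (α / 2) ^ (p + γ) * (ρ / 4) ^ (n - 1))
    (g := fun r => u r ^ (p + γ) * m r) (by linarith)
    (intervalIntegrable_const (μ := volume))
    (ContinuousOn.intervalIntegrable_of_Icc (by linarith)
      (((hu.cont.mono hsub).rpow_const fun r hr => Or.inl (hpos r (hsub hr)).ne').mul
        (hw.cont.mono hsub)))
    fun r hr => by
      have h1 := hu.half_le hw hp hpos hα.symm (hsub hr) hr.2
      have h2 : (ρ / 4) ^ (n - 1) ≤ m r := by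
        refine le_trans ?_ (hm r (hsub hr) (hr.2.trans hρδ.le))
        have : ρ / 4 ≤ r / 2 := by linarith [hr.1]
        gcongr
      have h3 := hpos r (hsub hr)
      have : 0 ≤ p + γ := by linarith
      gcongr
  rw [intervalIntegral.integral_const, smul_eq_mul] at hlow
  have hval : (ρ - ρ / 2) * ((α / 2) ^ (p + γ) * (ρ / 4) ^ (n - 1)) =
      (1 / 2) ^ (p + γ) * (1 / 4) ^ (n - 1) * (1 / 2) * α ^ (p + γ + (1 - p) / 2 * n) := by
    have h1 : ρ ^ n = α ^ ((1 - p) / 2 * n) := by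
      rw [hρ, ← Real.rpow_natCast, ← Real.rpow_mul hα0.le]
    have h2 : ρ * ρ ^ (n - 1) = ρ ^ n := by
      rw [← pow_succ', Nat.sub_add_cancel (by omega)]
    rw [Real.rpow_add hα0 (p + γ), ← h1, ← h2, div_eq_mul_one_div α,
      Real.mul_rpow hα0.le (by norm_num), div_eq_mul_one_div ρ 4, mul_pow]
    ring
  linarith

/-! ### Regularity on the closed half-line -/

theorem exists_derivs_of_contDiffOn {u : ℝ → ℝ} (hu : ContDiffOn ℝ 2 u (Ici 0)) :
    ∃ d e : ℝ → ℝ, ContinuousOn d (Ici 0) ∧ ContinuousOn e (Ici 0) ∧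
      HasDerivWithinAt u (d 0) (Ici 0) 0 ∧ (∀ r > 0, HasDerivAt u (d r) r) ∧
      (∀ r > 0, HasDerivAt d (e r) r) ∧ ∀ r > 0, deriv (deriv u) r = e r := by
  have hd : ContDiffOn ℝ 1 (derivWithin u (Ici 0)) (Ici 0) :=
    hu.derivWithin (uniqueDiffOn_Ici 0) (by norm_num)
  have hI : ∀ r : ℝ, 0 < r → Ici (0:ℝ) ∈ nhds r := fun r hr => Ici_mem_nhds hr
  have h1 : ∀ r > (0:ℝ), HasDerivAt u (derivWithin u (Ici 0) r) r := fun r hr =>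
    ((hu.differentiableOn two_ne_zero r (le_of_lt hr)).hasDerivWithinAt).hasDerivAt (hI r hr)
  have h2 : ∀ r > (0:ℝ), HasDerivAt (derivWithin u (Ici 0))
      (derivWithin (derivWithin u (Ici 0)) (Ici 0) r) r := fun r hr =>
    ((hd.differentiableOn one_ne_zero r (le_of_lt hr)).hasDerivWithinAt).hasDerivAt (hI r hr)
  refine ⟨_, _, hd.continuousOn,
    hd.continuousOn_derivWithin (uniqueDiffOn_Ici 0) le_rfl,
    (hu.differentiableOn two_ne_zero 0 self_mem_Ici).hasDerivWithinAt, h1, h2, fun r hr => ?_⟩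
  have : deriv u =ᶠ[nhds r] derivWithin u (Ici 0) := by
    filter_upwards [Ioi_mem_nhds hr] with x hx using (h1 x hx).deriv
  rw [this.deriv_eq, (h2 r hr).deriv]

theorem H1.hasDerivAt_zero {ψ : ℝ → ℝ} (h : H1 ψ) : HasDerivAt ψ 1 0 := by
  have hd : DifferentiableAt ℝ ψ 0 := differentiableAt_of_deriv_ne_zero (by
    rw [h.2.2.1]; exact one_ne_zero)
  simpa only [h.2.2.1] using hd.hasDerivAt

theorem H1.exists_half_le {ψ : ℝ → ℝ} (h : H1 ψ) :
    ∃ δ > 0, ∀ r, 0 ≤ r → r ≤ δ → r / 2 ≤ ψ r := by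
  have h1 := h.hasDerivAt_zero.isLittleO.def (c := 1 / 2) (by norm_num)
  obtain ⟨δ, hδ, hb⟩ := Metric.eventually_nhds_iff.1 h1
  refine ⟨δ / 2, by positivity, fun r hr hrδ => ?_⟩
  have h2 := hb (y := r) (by rw [Real.dist_eq, sub_zero, abs_of_nonneg hr]; linarith)
  simp only [h.2.1, sub_zero, smul_eq_mul, mul_one, Real.norm_eq_abs, abs_of_nonneg hr] at h2
  linarith [(abs_le.1 h2).1]

theorem H1.radialWeight {n : ℕ} {ψ : ℝ → ℝ} (h : H1 ψ) (h2 : H2 ψ) (hn : 2 ≤ n) :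
    RadialWeight (fun r => ψ r ^ (n - 1)) (fun r => ((n:ℝ) - 1) * (deriv ψ r / ψ r)) where
  cont := h.1.continuousOn.pow _
  zero := by
    simp only [h.2.1]
    exact zero_pow (by omega)
  pos r hr := pow_pos (h.2.2.2.2 r hr) _
  hasDeriv r hr := by
    obtain ⟨d, -, -, -, -, hd, -⟩ := exists_derivs_of_contDiffOn h.1
    have hψ := h.2.2.2.2 r hr
    refine ((hd r hr).pow (n - 1)).congr_deriv ?_
    obtain ⟨j, rfl⟩ := Nat.exists_eq_add_of_le' hn
    rw [(hd r hr).deriv, show j + 2 - 1 = j + 1 by omega, Nat.add_sub_cancel, pow_succ]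
    push_cast
    field_simp
    ring
  coeff_nonneg r hr := by
    have hn1 : (2:ℝ) ≤ n := by exact_mod_cast hn
    exact mul_nonneg (by linarith) (div_nonneg (h2 r hr) (h.2.2.2.2 r hr).le)

theorem IsRadialSolution.exists_profile {n : ℕ} {p α : ℝ} {ψ u : ℝ → ℝ} (h : H1 ψ)
    (hn : 2 ≤ n) (hp : 1 < p) (hu : IsRadialSolution n p ψ u α) :
    ∃ d, RadialProfile p (fun r => ((n:ℝ) - 1) * (deriv ψ r / ψ r)) u d := by
  obtain ⟨d, e, cd, ce, -, hd, he, hee⟩ := exists_derivs_of_contDiffOn hu.1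
  obtain ⟨d₁, -, cd₁, -, hd₁0, hd₁, -⟩ := exists_derivs_of_contDiffOn h.1
  have hode : ∀ r > 0, e r + ((n:ℝ) - 1) * (deriv ψ r / ψ r) * d r
      + |u r| ^ (p - 1) * u r = 0 := fun r hr => by
    have := hu.2.2.2 r hr
    rwa [hee r hr, (hd r hr).deriv] at this
  have hd₁1 : d₁ 0 = 1 :=
    (uniqueDiffOn_Ici (0:ℝ) 0 self_mem_Ici).eq_deriv _ hd₁0 h.hasDerivAt_zero.hasDerivWithinAt
  have hd0 : d 0 = 0 := by
    have cu : ContinuousOn u (Ici 0) := hu.1.continuousOn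
    have cψ : ContinuousOn ψ (Ici 0) := h.1.continuousOn
    have cf : ContinuousOn (fun r => ((n:ℝ) - 1) * d₁ r * d r
        + ψ r * (e r + |u r| ^ (p - 1) * u r)) (Ici 0) :=
      ((continuousOn_const.mul cd₁).mul cd).add
        (cψ.mul (ce.add ((continuousOn_abs_rpow hp cu).mul cu)))
    have hlim := (cf 0 self_mem_Ici).mono_left (nhdsWithin_mono 0 Ioi_subset_Ici_self)
    have hev : (fun r => ((n:ℝ) - 1) * d₁ r * d r + ψ r * (e r + |u r| ^ (p - 1) * u r))
        =ᶠ[nhdsWithin 0 (Ioi 0)] fun _ => 0 := by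
      filter_upwards [self_mem_nhdsWithin] with r hr
      have hψ := h.2.2.2.2 r hr
      have h3 := hode r hr
      rw [(hd₁ r hr).deriv] at h3
      field_simp at h3
      linarith
    have := tendsto_nhds_unique (hlim.congr' hev) tendsto_const_nhds
    simp only [hd₁1, h.2.1, zero_mul, add_zero, mul_one] at this
    have hn1 : (2:ℝ) ≤ n := by exact_mod_cast hn
    exact (mul_eq_zero.1 this).resolve_left (by linarith)
  exact ⟨d, hu.1.continuousOn, cd, hd0, hd, fun r hr =>
    (he r hr).congr_deriv (by linarith [hode r hr])⟩

theorem lam1_nonneg {n : ℕ} {ψ : ℝ → ℝ} (h : ∀ r > 0, 0 ≤ ψ r) : 0 ≤ lam1 n ψ := by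
  refine Real.sInf_nonneg ?_
  rintro q ⟨φ, -, -, -, rfl⟩
  exact div_nonneg
    (setIntegral_nonneg measurableSet_Ioi fun r hr =>
      mul_nonneg (sq_nonneg _) (pow_nonneg (h r hr) _))
    (setIntegral_nonneg measurableSet_Ioi fun r hr =>
      mul_nonneg (sq_nonneg _) (pow_nonneg (h r hr) _))

theorem lam1_mul_le {n : ℕ} {ψ : ℝ → ℝ} (h : ∀ r > 0, 0 ≤ ψ r) {χ : ℝ → ℝ}
    (hχ : ContDiff ℝ 1 χ) (hχs : HasCompactSupport χ) :
    lam1 n ψ * ∫ r in Ioi (0:ℝ), (χ r) ^ 2 * ψ r ^ (n - 1) ≤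
      ∫ r in Ioi (0:ℝ), (deriv χ r) ^ 2 * ψ r ^ (n - 1) := by
  have hnn : ∀ φ : ℝ → ℝ, 0 ≤ ∫ r in Ioi (0:ℝ), (φ r) ^ 2 * ψ r ^ (n - 1) := fun φ =>
    setIntegral_nonneg measurableSet_Ioi fun r hr =>
      mul_nonneg (sq_nonneg _) (pow_nonneg (h r hr) _)
  rcases (hnn χ).eq_or_lt with h0 | h0
  · rw [← h0, mul_zero]
    exact hnn _
  · rw [← le_div_iff₀ h0]
    refine csInf_le ⟨0, ?_⟩ ⟨χ, hχ, hχs, h0.ne', rfl⟩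
    rintro q ⟨φ, -, -, -, rfl⟩
    exact div_nonneg (hnn _) (hnn _)

/-- Stability of radial solutions: for 3 ≤ n ≤ 10 and p > 1, or n ≥ 11 and
1 < p < p_c(n), there is a threshold α₀ ∈ (0,∞) for the initial value, below
which solutions are stable and above which they are unstable; moreover
α₀ ≥ (λ₁/p)^{1/(p-1)}. -/
theorem statement13 (n : ℕ) (hn : 3 ≤ n) (p : ℝ) (hp : 1 < p)
    (hnp : n ≤ 10 ∨ (11 ≤ n ∧ p < pJL n)) (ψ : ℝ → ℝ)
    (h1 : H1 ψ) (h2 : H2 ψ) (h3 : H3 ψ) :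
    ∃ α₀ : ℝ, 0 < α₀ ∧ (lam1 n ψ / p) ^ (1 / (p - 1)) ≤ α₀ ∧
      ∀ α : ℝ, 0 ≤ α → ∀ u : ℝ → ℝ, IsRadialSolution n p ψ u α →
        ((α ≤ α₀ → Stable n p ψ u) ∧ (α₀ < α → ¬ Stable n p ψ u)) := by
  have hw := h1.radialWeight h2 (by omega : 2 ≤ n)
  have hψ : ∀ r > 0, 0 ≤ ψ r := fun r hr => (h1.2.2.2.2 r hr).le
  set k : ℝ → ℝ := fun r => ((n:ℝ) - 1) * (deriv ψ r / ψ r)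
  set m : ℝ → ℝ := fun r => ψ r ^ (n - 1)
  have hn1 : (3:ℝ) ≤ n := by exact_mod_cast hn
  obtain ⟨c, hc, hev⟩ := h3
  obtain ⟨K, hK, hpoin⟩ := hw.exists_poincare (c := ((n:ℝ) - 1) * c)
    (mul_pos (by linarith) hc) (hev.mono fun r hr => mul_le_mul_of_nonneg_left hr (by linarith))
  obtain ⟨δ, hδ, hψδ⟩ := h1.exists_half_le
  obtain ⟨A, hA⟩ := hw.exists_bound_stable hn hp hnp hδ fun r hr hrδ =>
    pow_le_pow_left₀ (by positivity) (hψδ r hr hrδ) _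
  set S : Set ℝ := {α | 0 ≤ α ∧ ∃ v e, RadialProfile p k v e ∧ v 0 = α ∧ WeightedStable p m v}
  have hbdd : BddAbove S := ⟨A, by
    rintro α ⟨-, v, e, hv, rfl, hs⟩
    exact hA v e hv hs⟩
  have hne : S.Nonempty := ⟨0, le_rfl, _, _, RadialProfile.zero, rfl,
    weightedStable_of_poincare hw hp RadialProfile.zero hK.le hpoin rfl le_rfl (by positivity)⟩
  refine ⟨max (sSup S) (max ((lam1 n ψ / p) ^ (1 / (p - 1))) ((K / p) ^ (1 / (p - 1)))),
    lt_max_of_lt_right (lt_max_of_lt_right (by positivity)),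
    (le_max_left _ _).trans (le_max_right _ _), fun α hα u hu => ?_⟩
  obtain ⟨d, hprof⟩ := hu.exists_profile h1 (by omega) hp
  have hu0 : u 0 = α := hu.2.1
  refine ⟨fun hle => ?_, fun hlt hs => ?_⟩
  · change WeightedStable p m u
    rcases le_max_iff.1 hle with h | h
    · rcases h.lt_or_eq with h | h
      · obtain ⟨β, ⟨-, v, e, hv, rfl, hs⟩, hlt⟩ := exists_lt_of_lt_csSup hne h
        exact hs.of_lt hw hp hv hprof (hu0.symm ▸ hα) (hu0.symm ▸ hlt)
      · refine weightedStable_of_tendsto hw hp hprof hu0 hα fun η hη => ?_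
        obtain ⟨β, hβ, hlt⟩ := exists_lt_of_lt_csSup hne (show α - η < sSup S by linarith)
        have hβα : β ≤ α := h ▸ le_csSup hbdd hβ
        obtain ⟨hβ0, v, e, hv, rfl, hs⟩ := hβ
        exact ⟨v, e, hv, hs, hβ0, hβα, hlt⟩
    · rcases le_max_iff.1 h with h | h
      · exact weightedStable_of_poincare hw hp hprof (lam1_nonneg hψ)
          (fun χ hχ hχs => lam1_mul_le hψ hχ hχs) hu0 hα h
      · exact weightedStable_of_poincare hw hp hprof hK.le hpoin hu0 hα h
  · exact (le_csSup hbdd (⟨hα, u, d, hprof, hu0, hs⟩ : α ∈ S)).not_gt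
      ((le_max_left _ _).trans_lt hlt)
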